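/- Under the correlated Gaussian model with parameter ε > 0, let λ_n be a sequence with 4 < λ_n ≤ D√n for a fixed constant D > 0, and set Y_n = X_n + (λ_n/√n)·𝟙𝟙ᵀ. Then there exist real random variables R_n and R'_n such that for all n, √n·(λ₁(n^{-1/2} Y_n) − λ_n − 1/λ_n) = (1/n)·Σ_{i=1}^n Σ_{j=1}^n X_n(i,j) + (√n/λ_n)·R_n + R'_n, where R_n = O_P(n^{-min{ε,1}/2}) and R'_n = O_P(√n/λ_n²). -/

import Mathlib

open MeasureTheory ProbabilityTheory Filter Topology

noncomputable section

/-- The largest eigenvalue of a real symmetric matrix, realised as the supremum of its set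
of real eigenvalues. -/
def lam1 {n : ℕ} (A : Matrix (Fin n) (Fin n) ℝ) : ℝ :=
  sSup {t : ℝ | ∃ v : Fin n → ℝ, v ≠ 0 ∧ A.mulVec v = t • v}

/-- A finite family of real random variables is a centered (jointly) Gaussian vector:
every linear combination of the coordinates has a centered Gaussian law. -/
def IsCenteredGaussianVec {Ω : Type*} [MeasureSpace Ω] {ι : Type*} [Fintype ι]
    (X : ι → Ω → ℝ) : Prop :=
  (∀ i, Measurable (X i)) ∧
    ∀ c : ι → ℝ, ∃ v : NNReal,
      Measure.map (fun ω => ∑ i, c i * X i ω) (volume : Measure Ω) = gaussianReal 0 v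

/-- Covariance of two real random variables. -/
def pcov {Ω : Type*} [MeasureSpace Ω] (W V : Ω → ℝ) : ℝ :=
  (∫ ω, W ω * V ω) - (∫ ω, W ω) * ∫ ω, V ω

/-- Variance of a real random variable. -/
def pvar {Ω : Type*} [MeasureSpace Ω] (W : Ω → ℝ) : ℝ := pcov W W

/-- The correlated Gaussian model with parameter `ε` and constant `C`: for each `n`,
`X n` is a random symmetric `n × n` matrix whose entries `(X_{ij})_{i ≤ j}` form a centered
Gaussian vector with unit variances and pairwise correlations bounded by `C * n ^ (-(1+ε))`. -/
structure CorrGaussian (Ω : Type*) [MeasureSpace Ω]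
    (X : (n : ℕ) → Ω → Matrix (Fin n) (Fin n) ℝ) (C ε : ℝ) : Prop where
  symm : ∀ n ω, (X n ω).IsSymm
  gauss : ∀ n, IsCenteredGaussianVec fun p : Fin n × Fin n => fun ω => X n ω p.1 p.2
  var_one : ∀ n, ∀ i j : Fin n, ∫ ω, (X n ω i j) ^ 2 = 1
  corr_le : ∀ n, ∀ i j i' j' : Fin n, ¬((i, j) = (i', j') ∨ (i, j) = (j', i')) →
    |∫ ω, X n ω i j * X n ω i' j'| ≤ C * (n : ℝ) ^ (-(1 + ε))

/-- The all-ones `n × n` matrix `𝟙𝟙ᵀ`. -/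
def onesMat (n : ℕ) : Matrix (Fin n) (Fin n) ℝ := Matrix.of fun _ _ => 1

/-- The operator (spectral) norm of a real matrix, i.e. the norm of the induced map on
Euclidean space. -/
def opNorm {n : ℕ} (A : Matrix (Fin n) (Fin n) ℝ) : ℝ :=
  ‖(Matrix.toEuclideanLin A).toContinuousLinearMap‖

/-- `T n = O_P(a n)`: for every `δ > 0` there are `M > 0` and `n₀` such that
`P(|T n| > M * a n) ≤ δ` for all `n ≥ n₀`. -/
def IsBigOP {Ω : Type*} [MeasureSpace Ω] (T : ℕ → Ω → ℝ) (a : ℕ → ℝ) : Prop :=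
  ∀ δ : ℝ, 0 < δ → ∃ M : ℝ, 0 < M ∧ ∃ n₀ : ℕ, ∀ n ≥ n₀,
    (volume {ω | M * a n < |T n ω|}).toReal ≤ δ

/-- The sparse Rademacher(p) law `p δ_{-1} + (1 - 2p) δ_0 + p δ_1`. -/
def sparseRademacher (p : ℝ) : Measure ℝ :=
  ENNReal.ofReal p • Measure.dirac (-1) + ENNReal.ofReal (1 - 2 * p) • Measure.dirac 0 +
    ENNReal.ofReal p • Measure.dirac 1

end


/-! ### Gaussian moments -/

open scoped Nat in
lemma gm_std (k : ℕ) : ∫ x, x ^ (2 * k) ∂(gaussianReal 0 1) = ((2 * k - 1 : ℕ)‼ : ℝ) := by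
  rw [integral_gaussianReal_eq_integral_smul (by simp)]
  have h1 : ∀ x : ℝ, gaussianPDFReal 0 1 x • x ^ (2 * k) =
      (fun y : ℝ => (√(2 * Real.pi))⁻¹ * (y ^ (2 * (k : ℝ)) * Real.exp (-(1/2) * y ^ (2 : ℝ)))) |x| := by
    intro x
    simp only [gaussianPDFReal, smul_eq_mul]
    have e1 : |x| ^ (2 * (k : ℝ)) = x ^ (2 * k) := by
      rw [Real.rpow_mul (abs_nonneg _), Real.rpow_natCast, Real.rpow_two, sq_abs, pow_mul]
    rw [e1, Real.rpow_two, sq_abs]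
    simp
    ring_nf
  refine (integral_congr_ae (Eventually.of_forall h1)).trans ((integral_comp_abs (f := fun y : ℝ => (√(2 * Real.pi))⁻¹ * (y ^ (2 * (k : ℝ)) * Real.exp (-(1/2) * y ^ (2 : ℝ))))).trans ?_)
  rw [integral_const_mul,
    integral_rpow_mul_exp_neg_mul_rpow (by norm_num) (by have : (0:ℝ) ≤ k := by positivity
                                                         linarith) (by norm_num)]
  have e2 : (2 * (k : ℝ) + 1) / 2 = k + 1 / 2 := by ring
  have e4 : -(2 * (k : ℝ) + 1) / 2 = -((k : ℝ) + 1 / 2) := by ring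
  rw [e2, e4, Real.Gamma_nat_add_half]
  have e3 : ((1 : ℝ) / 2) ^ (-((k : ℝ) + 1 / 2)) = 2 ^ k * √2 := by
    rw [one_div, Real.inv_rpow (by norm_num), ← Real.rpow_neg (by norm_num), neg_neg,
      Real.rpow_add (by norm_num), Real.rpow_natCast, Real.sqrt_eq_rpow]
    norm_num
  rw [e3, Real.sqrt_mul (by norm_num)]
  have : √Real.pi ≠ 0 := by positivity
  field_simp

open scoped Nat in
lemma gm (k : ℕ) (v : NNReal) :
    ∫ x, x ^ (2 * k) ∂(gaussianReal 0 v) = (v : ℝ) ^ k * ((2 * k - 1 : ℕ)‼ : ℝ) := by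
  have h := gaussianReal_map_const_mul (μ := 0) (v := 1) (√(v : ℝ))
  have h2 : gaussianReal 0 v = (gaussianReal 0 1).map (fun x => √(v : ℝ) * x) := by
    rw [h]; congr 1
    · simp
    · ext; simp
  rw [h2, integral_map (by fun_prop) (by fun_prop)]
  simp_rw [mul_pow]
  rw [integral_const_mul, gm_std, pow_mul, Real.sq_sqrt v.coe_nonneg]

lemma gexp_std : ∫ x, Real.exp (x ^ 2 / 4) ∂(gaussianReal 0 1) = √2 := by
  rw [integral_gaussianReal_eq_integral_smul (by simp)]
  have h1 : ∀ x : ℝ, gaussianPDFReal 0 1 x • Real.exp (x ^ 2 / 4) =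
      (√(2 * Real.pi))⁻¹ * Real.exp (-(1/4) * x ^ 2) := by
    intro x
    simp only [gaussianPDFReal, smul_eq_mul]
    simp only [NNReal.coe_one, mul_one, sub_zero]
    rw [mul_assoc, ← Real.exp_add]
    ring_nf
  simp_rw [h1]
  rw [integral_const_mul, integral_gaussian]
  have : √Real.pi ≠ 0 := by positivity
  have e : Real.pi / (1/4) = (2 * Real.pi) * 2 := by ring
  rw [e, Real.sqrt_mul (x := 2 * Real.pi) (by positivity)]
  have : √(2 * Real.pi) ≠ 0 := by positivity
  field_simp

lemma gexp (v : NNReal) (hv : v ≠ 0) :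
    ∫ x, Real.exp (x ^ 2 / (4 * v)) ∂(gaussianReal 0 v) = √2 := by
  have h := gaussianReal_map_const_mul (μ := 0) (v := 1) (√(v : ℝ))
  have h2 : gaussianReal 0 v = (gaussianReal 0 1).map (fun x => √(v : ℝ) * x) := by
    rw [h]; congr 1
    · simp
    · ext; simp
  rw [h2, integral_map (by fun_prop) (by fun_prop)]
  rw [← gexp_std]
  congr 1; ext x
  have : (v : ℝ) ≠ 0 := by exact_mod_cast hv
  rw [mul_pow, Real.sq_sqrt v.coe_nonneg]
  congr 1
  field_simp

/-- iid Gaussian vector -/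
noncomputable def gvec (n : ℕ) : Measure (Fin n → ℝ) := Measure.pi (fun _ => gaussianReal 0 1)

/-- iid Gaussian matrix -/
noncomputable def gmat (n : ℕ) : Measure (Fin n → Fin n → ℝ) := Measure.pi (fun _ => gvec n)

instance (n : ℕ) : IsProbabilityMeasure (gvec n) := by unfold gvec; infer_instance
instance (n : ℕ) : IsProbabilityMeasure (gmat n) := by unfold gmat; infer_instance

lemma isGaussian_pi' {ι : Type*} [Fintype ι] {E : ι → Type*} [∀ i, NormedAddCommGroup (E i)]
    [∀ i, NormedSpace ℝ (E i)] [∀ i, MeasurableSpace (E i)] [∀ i, BorelSpace (E i)]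
    [∀ i, CompleteSpace (E i)] [∀ i, SecondCountableTopology (E i)]
    (μ : ∀ i, Measure (E i)) [∀ i, IsGaussian (μ i)] : IsGaussian (Measure.pi μ) := by
  have h : iIndepFun (fun i (ω : ∀ i, E i) => ω i) (Measure.pi μ) :=
    iIndepFun_pi (X := fun i => id) (fun i => aemeasurable_id)
  have h2 := iIndepFun.hasGaussianLaw (X := fun i (ω : ∀ i, E i) => ω i) (P := Measure.pi μ)
    (fun i => ⟨by rw [(measurePreserving_eval μ i).map_eq]; infer_instance⟩) h
  have := h2.isGaussian_map
  simpa using this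

instance (n : ℕ) : IsGaussian (gvec n) := by unfold gvec; exact isGaussian_pi' _
instance (n : ℕ) : IsGaussian (gmat n) := by unfold gmat; exact isGaussian_pi' _

lemma gvec_eval (n : ℕ) (i : Fin n) : (gvec n).map (fun x => x i) = gaussianReal 0 1 :=
  (measurePreserving_eval (fun _ : Fin n => gaussianReal 0 1) i).map_eq

lemma gvec_int (n : ℕ) (i : Fin n) : ∫ x, x i ∂(gvec n) = 0 := by
  have := integral_map (μ := gvec n) (φ := fun x => x i) (f := fun y : ℝ => y) (measurable_pi_apply i).aemeasurable (by fun_prop)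
  rw [← this, gvec_eval, integral_id_gaussianReal]

lemma gvec_memLp (n : ℕ) (i : Fin n) (p : ENNReal) (hp : p ≠ ⊤) :
    MemLp (fun x : Fin n → ℝ => x i) p (gvec n) :=
  IsGaussian.memLp_dual (gvec n) (ContinuousLinearMap.proj i) p hp

lemma gvec_int2 (n : ℕ) (i j : Fin n) : ∫ x, x i * x j ∂(gvec n) = if i = j then 1 else 0 := by
  split_ifs with h
  · subst h
    have := integral_map (μ := gvec n) (φ := fun x => x i) (f := fun y : ℝ => y ^ (2 * 1)) (measurable_pi_apply i).aemeasurable (by fun_prop)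
    rw [gvec_eval, gm_std] at this
    simp only [← sq]
    simpa using this.symm
  · have hI : iIndepFun (fun i (ω : Fin n → ℝ) => ω i) (gvec n) :=
      iIndepFun_pi (X := fun i => id) (fun i => aemeasurable_id)
    have := (hI.indepFun h).integral_fun_mul_eq_mul_integral (measurable_pi_apply i).aestronglyMeasurable (measurable_pi_apply j).aestronglyMeasurable
    rw [this, gvec_int, zero_mul]

lemma gvec_lin_sq (n : ℕ) (c : Fin n → ℝ) :
    ∫ x, (∑ i, c i * x i) ^ 2 ∂(gvec n) = ∑ i, c i ^ 2 := by
  have hintg : ∀ i j, Integrable (fun x : Fin n → ℝ => x i * x j) (gvec n) := fun i j =>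
    (gvec_memLp n i 2 (by simp)).integrable_mul (gvec_memLp n j 2 (by simp))
  have : ∀ x : Fin n → ℝ, (∑ i, c i * x i) ^ 2 = ∑ i, ∑ j, c i * c j * (x i * x j) := by
    intro x
    rw [sq, Finset.sum_mul_sum]
    refine Finset.sum_congr rfl fun i _ => Finset.sum_congr rfl fun j _ => by ring
  simp_rw [this]
  rw [integral_finsetSum _ fun i _ => integrable_finsetSum _ fun j _ => (hintg i j).const_mul _]
  refine Finset.sum_congr rfl fun i _ => ?_
  rw [integral_finsetSum _ fun j _ => (hintg i j).const_mul _]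
  simp_rw [integral_const_mul, gvec_int2]
  simp [sq]

lemma gvec_lin (n : ℕ) (c : Fin n → ℝ) :
    (gvec n).map (fun x => ∑ i, c i * x i) = gaussianReal 0 (∑ i, c i ^ 2).toNNReal := by
  let L : StrongDual ℝ (Fin n → ℝ) := ∑ i, c i • ContinuousLinearMap.proj (R := ℝ) (φ := fun _ : Fin n => ℝ) i
  have hL : ∀ x, L x = ∑ i, c i * x i := by intro x; simp [L]
  have h := IsGaussian.map_eq_gaussianReal (μ := gvec n) L
  have h0 : ∫ x, L x ∂(gvec n) = 0 := by
    simp_rw [hL]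
    rw [integral_finsetSum _ fun i _ => ((gvec_memLp n i 1 (by simp)).integrable le_rfl).const_mul _]
    simp [integral_const_mul, gvec_int]
  have hv : Var[L; gvec n] = ∑ i, c i ^ 2 := by
    rw [variance_of_integral_eq_zero (by fun_prop) h0]
    simp_rw [hL]
    exact gvec_lin_sq n c
  rw [h0, hv] at h
  rw [← h]
  congr 1; ext x; exact (hL x).symm


/-! ### Polarization and Isserlis/Wick comparison -/

lemma incl_excl {ι τ : Type*} [Fintype ι] [DecidableEq ι] [Fintype τ]
    (supp : τ → Finset ι) (F : τ → ℝ) :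
    ∑ S : Finset ι, (-1 : ℝ) ^ (Sᶜ.card) * ∑ w, (if supp w ⊆ S then F w else 0) =
      ∑ w, if supp w = Finset.univ then F w else 0 := by
  simp_rw [Finset.mul_sum]
  rw [Finset.sum_comm]
  refine Finset.sum_congr rfl fun w _ => ?_
  have key : ∑ S : Finset ι, (-1 : ℝ) ^ (Sᶜ.card) * (if supp w ⊆ S then (1:ℝ) else 0) =
      if supp w = Finset.univ then 1 else 0 := by
    have h1 : ∑ S : Finset ι, (-1 : ℝ) ^ (Sᶜ.card) * (if supp w ⊆ S then (1:ℝ) else 0) =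
        ∑ T : Finset ι, (-1 : ℝ) ^ (T.card) * (if T ⊆ (supp w)ᶜ then (1:ℝ) else 0) := by
      refine Fintype.sum_equiv ((compl_involutive (α := Finset ι)).toPerm) _ _ fun S => ?_
      simp only [Function.Involutive.coe_toPerm, Finset.compl_subset_compl]
    rw [h1]
    have h2 := Finset.sum_powerset_neg_one_pow_card (x := (supp w)ᶜ)
    have h3 : ∑ T : Finset ι, (-1 : ℝ) ^ (T.card) * (if T ⊆ (supp w)ᶜ then (1:ℝ) else 0) =
        ((∑ m ∈ (supp w)ᶜ.powerset, (-1 : ℤ) ^ m.card : ℤ) : ℝ) := by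
      push_cast
      rw [← Finset.sum_filter_add_sum_filter_not Finset.univ (fun T => T ⊆ (supp w)ᶜ)]
      have : (Finset.univ.filter fun T => T ⊆ (supp w)ᶜ) = (supp w)ᶜ.powerset := by
        ext; simp
      rw [this]
      have e0 : ∑ x ∈ Finset.univ.filter (fun T => ¬ T ⊆ (supp w)ᶜ),
          (-1 : ℝ) ^ (x.card) * (if x ⊆ (supp w)ᶜ then (1:ℝ) else 0) = 0 := by
        refine Finset.sum_eq_zero fun x hx => ?_
        rw [Finset.mem_filter] at hx
        rw [if_neg hx.2, mul_zero]
      rw [e0, add_zero]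
      refine Finset.sum_congr rfl fun x hx => ?_
      rw [if_pos (Finset.mem_powerset.1 hx), mul_one]
    rw [h3, h2]
    by_cases h : supp w = Finset.univ
    · simp [h]
    · rw [if_neg h, if_neg]
      · simp
      · rwa [Finset.compl_eq_empty_iff]
  calc _ = (∑ S : Finset ι, (-1 : ℝ) ^ (Sᶜ.card) * (if supp w ⊆ S then (1:ℝ) else 0)) * F w := by
        rw [Finset.sum_mul]
        refine Finset.sum_congr rfl fun S _ => ?_
        split_ifs <;> ring
    _ = _ := by rw [key]; split_ifs <;> ring

lemma polar {ι : Type*} [Fintype ι] [DecidableEq ι] (x : ι → ℝ) :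
    ∑ S : Finset ι, (-1 : ℝ) ^ (Sᶜ.card) * (∑ i ∈ S, x i) ^ (Fintype.card ι) =
      (Fintype.card ι).factorial * ∏ i, x i := by
  have h1 : ∀ S : Finset ι, (∑ i ∈ S, x i) ^ (Fintype.card ι) =
      ∑ w : ι → ι, (if Finset.univ.image w ⊆ S then ∏ t, x (w t) else 0) := by
    intro S
    have := Finset.prod_univ_sum (fun _ : ι => S) (fun _ i => x i)
    rw [Finset.prod_const, Finset.card_univ] at this
    rw [this, ← Finset.sum_filter]
    refine Finset.sum_congr ?_ fun _ _ => rfl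
    ext w
    simp [Fintype.mem_piFinset, Finset.image_subset_iff]
  simp_rw [h1]
  rw [incl_excl]
  have h2 := Fintype.sum_of_injective (fun σ : Equiv.Perm ι => (σ : ι → ι))
    (fun a b h => by ext i; exact congrFun h i) (fun _ => ∏ i, x i)
    (fun w => if Finset.univ.image w = Finset.univ then ∏ t, x (w t) else 0)
    (by
      intro w hw
      rw [if_neg]
      intro h
      apply hw
      have hs : Function.Surjective w := by
        intro y
        have : y ∈ Finset.univ.image w := by rw [h]; simp
        simpa using this
      exact ⟨Equiv.ofBijective w (Finite.surjective_iff_bijective.1 hs), rfl⟩)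
    (by
      intro σ
      have : Finset.univ.image (σ : ι → ι) = Finset.univ := by
        ext y; simp
      simp only [this, if_true]
      exact (Equiv.prod_comp σ x).symm)
  rw [← h2]
  simp [Fintype.card_perm]

/-- the Wick functional (up to normalisation) -/
noncomputable def wickQ {ι : Type*} [Fintype ι] [DecidableEq ι] (k : ℕ) (c : ι → ι → ℝ) : ℝ :=
  ∑ w : Fin k → ι × ι, if (Finset.univ.image (fun t => (w t).1) ∪ Finset.univ.image (fun t => (w t).2))
    = Finset.univ then ∏ t, c (w t).1 (w t).2 else 0

lemma wickQ_mono {ι : Type*} [Fintype ι] [DecidableEq ι] (k : ℕ) (c c' : ι → ι → ℝ)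
    (h : ∀ i j, |c i j| ≤ c' i j) : wickQ k c ≤ wickQ k c' := by
  unfold wickQ
  refine Finset.sum_le_sum fun w _ => ?_
  split_ifs
  · refine (le_abs_self _).trans ?_
    rw [Finset.abs_prod]
    exact Finset.prod_le_prod (fun _ _ => abs_nonneg _) fun _ _ => h _ _
  · exact le_rfl

lemma wickQ_eq {ι : Type*} [Fintype ι] [DecidableEq ι] (k : ℕ) (c : ι → ι → ℝ) :
    ∑ S : Finset ι, (-1 : ℝ) ^ (Sᶜ.card) * (∑ i ∈ S, ∑ j ∈ S, c i j) ^ k = wickQ k c := by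
  unfold wickQ
  rw [← incl_excl]
  refine Finset.sum_congr rfl fun S _ => ?_
  congr 1
  have := Finset.prod_univ_sum (fun _ : Fin k => S ×ˢ S) (fun _ p => c p.1 p.2)
  rw [Finset.prod_const, Finset.card_univ, Fintype.card_fin, Finset.sum_product] at this
  rw [this, ← Finset.sum_filter]
  refine Finset.sum_congr ?_ fun _ _ => rfl
  ext w
  simp [Fintype.mem_piFinset, Finset.image_subset_iff, Finset.union_subset_iff, forall_and]

set_option linter.unusedSectionVars false

section wick
variable {Ω : Type*} [MeasurableSpace Ω] {μ : Measure Ω} [IsProbabilityMeasure μ]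

lemma memLp_of_gauss {Z : Ω → ℝ} (hZ : AEMeasurable Z μ) {v : NNReal}
    (h : μ.map Z = gaussianReal 0 v) (p : ENNReal) (hp : p ≠ ⊤) : MemLp Z p μ := by
  have := memLp_id_gaussianReal' (μ := 0) (v := v) p hp
  rw [← h] at this
  exact (memLp_map_measure_iff (by fun_prop) hZ).1 this

open scoped Nat in
lemma int_gauss {Z : Ω → ℝ} (hZ : AEMeasurable Z μ) {v : NNReal}
    (h : μ.map Z = gaussianReal 0 v) (k : ℕ) :
    ∫ ω, Z ω ^ (2 * k) ∂μ = (∫ ω, Z ω ^ 2 ∂μ) ^ k * ((2 * k - 1 : ℕ)‼ : ℝ) := by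
  have e : ∀ m, ∫ ω, Z ω ^ (2 * m) ∂μ = (v : ℝ) ^ m * ((2 * m - 1 : ℕ)‼ : ℝ) := by
    intro m
    have := integral_map (μ := μ) (f := fun y : ℝ => y ^ (2 * m)) hZ (by fun_prop)
    rw [← this, h, gm]
  have e1 := e 1
  simp at e1
  rw [e, e1]

lemma integrable_pow_of_gauss {Z : Ω → ℝ} (hZ : AEMeasurable Z μ) {v : NNReal}
    (h : μ.map Z = gaussianReal 0 v) (m : ℕ) : Integrable (fun ω => Z ω ^ m) μ := by
  have := (memLp_of_gauss hZ h m (by simp)).integrable_norm_pow'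
  refine this.congr' (by fun_prop) ?_
  filter_upwards with ω
  simp

open scoped Nat in
lemma wick {ι : Type*} [Fintype ι] [DecidableEq ι] (k : ℕ) (hk : Fintype.card ι = 2 * k)
    (X : ι → Ω → ℝ) (hm : ∀ i, AEMeasurable (X i) μ)
    (hG : ∀ S : Finset ι, ∃ v : NNReal, μ.map (fun ω => ∑ i ∈ S, X i ω) = gaussianReal 0 v) :
    ((2 * k).factorial : ℝ) * ∫ ω, ∏ i, X i ω ∂μ =
      ((2 * k - 1 : ℕ)‼ : ℝ) * wickQ k (fun i j => ∫ ω, X i ω * X j ω ∂μ) := by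
  have hmS : ∀ S : Finset ι, AEMeasurable (fun ω => ∑ i ∈ S, X i ω) μ := fun S => by fun_prop
  have hX1 : ∀ i, MemLp (X i) 2 μ := by
    intro i
    obtain ⟨v, hv⟩ := hG {i}
    simp only [Finset.sum_singleton] at hv
    exact memLp_of_gauss (hm i) hv 2 (by simp)
  have hXX : ∀ i j, Integrable (fun ω => X i ω * X j ω) μ := fun i j =>
    (hX1 i).integrable_mul (hX1 j)
  have hsq : ∀ S : Finset ι, ∫ ω, (∑ i ∈ S, X i ω) ^ 2 ∂μ =
      ∑ i ∈ S, ∑ j ∈ S, ∫ ω, X i ω * X j ω ∂μ := by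
    intro S
    simp_rw [sq, Finset.sum_mul_sum]
    rw [integral_finsetSum _ fun i _ => integrable_finsetSum _ fun j _ => hXX i j]
    refine Finset.sum_congr rfl fun i _ => ?_
    rw [integral_finsetSum _ fun j _ => hXX i j]
  have hintg : ∀ S : Finset ι, Integrable (fun ω => (∑ i ∈ S, X i ω) ^ (2 * k)) μ := by
    intro S
    obtain ⟨v, hv⟩ := hG S
    exact integrable_pow_of_gauss (hmS S) hv _
  rw [← integral_const_mul]
  have : ∀ ω, ((2 * k).factorial : ℝ) * ∏ i, X i ω =
      ∑ S : Finset ι, (-1 : ℝ) ^ (Sᶜ.card) * (∑ i ∈ S, X i ω) ^ (2 * k) := by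
    intro ω
    have := polar (fun i => X i ω)
    rw [hk] at this
    exact this.symm
  simp_rw [this]
  rw [integral_finsetSum _ fun S _ => (hintg S).const_mul _, ← wickQ_eq, Finset.mul_sum]
  refine Finset.sum_congr rfl fun S _ => ?_
  obtain ⟨v, hv⟩ := hG S
  rw [integral_const_mul, int_gauss (hmS S) hv, hsq]
  ring

lemma wick_integrable {ι : Type*} [Fintype ι] [DecidableEq ι]
    (X : ι → Ω → ℝ) (hm : ∀ i, AEMeasurable (X i) μ)
    (hG : ∀ S : Finset ι, ∃ v : NNReal, μ.map (fun ω => ∑ i ∈ S, X i ω) = gaussianReal 0 v) :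
    Integrable (fun ω => ∏ i, X i ω) μ := by
  have hmS : ∀ S : Finset ι, AEMeasurable (fun ω => ∑ i ∈ S, X i ω) μ := fun S => by fun_prop
  have hintg : ∀ S : Finset ι, Integrable (fun ω => (∑ i ∈ S, X i ω) ^ (Fintype.card ι)) μ := by
    intro S
    obtain ⟨v, hv⟩ := hG S
    exact integrable_pow_of_gauss (hmS S) hv _
  have h0 : (((Fintype.card ι).factorial : ℕ) : ℝ) ≠ 0 := by positivity
  have : (fun ω => ∏ i, X i ω) = fun ω => (((Fintype.card ι).factorial : ℕ) : ℝ)⁻¹ *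
      ∑ S : Finset ι, (-1 : ℝ) ^ (Sᶜ.card) * (∑ i ∈ S, X i ω) ^ (Fintype.card ι) := by
    ext ω
    rw [polar]
    field_simp
  rw [this]
  exact (integrable_finsetSum _ fun S _ => (hintg S).const_mul _).const_mul _

/-- centered Gaussian family with explicit measure -/
def GV (μ : Measure Ω) {ι : Type*} [Fintype ι] (X : ι → Ω → ℝ) : Prop :=
  (∀ i, Measurable (X i)) ∧ ∀ c : ι → ℝ, ∃ v : NNReal,
    μ.map (fun ω => ∑ i, c i * X i ω) = gaussianReal 0 v

lemma GV.sub {ι κ : Type*} [Fintype ι] [DecidableEq ι] {X : ι → Ω → ℝ} (h : GV μ X)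
    (w : κ → ι) (S : Finset κ) :
    ∃ v : NNReal, μ.map (fun ω => ∑ t ∈ S, X (w t) ω) = gaussianReal 0 v := by
  obtain ⟨v, hv⟩ := h.2 (fun p => ∑ t ∈ S, if w t = p then 1 else 0)
  refine ⟨v, ?_⟩
  rw [← hv]
  congr 1
  ext ω
  simp_rw [Finset.sum_mul]
  rw [Finset.sum_comm]
  refine Finset.sum_congr rfl fun t _ => ?_
  simp

end wick

lemma pow_expand (n : ℕ) (m : ℕ) : ∀ i j : Fin n, ∃ coef : (Fin m → Fin n × Fin n) → ℝ,
    (∀ w, 0 ≤ coef w) ∧ ∀ A : Matrix (Fin n) (Fin n) ℝ,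
      (A ^ m) i j = ∑ w, coef w * ∏ t, A (w t).1 (w t).2 := by
  induction m with
  | zero =>
    intro i j
    refine ⟨fun _ => if i = j then 1 else 0, fun w => by split_ifs <;> norm_num, fun A => ?_⟩
    simp [Matrix.one_apply]
  | succ m ih =>
    intro i j
    choose coef h0 h using fun q => ih q j
    refine ⟨fun w => if (w 0).1 = i then coef (w 0).2 (Fin.tail w) else 0, fun w => ?_, fun A => ?_⟩
    · dsimp only
      split_ifs
      · exact h0 _ _
      · exact le_rfl
    · rw [pow_succ', Matrix.mul_apply]
      simp_rw [h _ A]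
      rw [← (Fin.consEquiv (fun _ : Fin (m+1) => Fin n × Fin n)).sum_comp, Fintype.sum_prod_type,
        Fintype.sum_prod_type]
      simp only [Fin.consEquiv_apply, Fin.cons_zero, Fin.prod_univ_succ, Fin.cons_succ]
      symm
      rw [Finset.sum_eq_single i]
      · refine Finset.sum_congr rfl fun q _ => ?_
        rw [Finset.mul_sum]
        refine Finset.sum_congr rfl fun w _ => ?_
        have e : Fin.tail ((Fin.consEquiv fun _ : Fin (m + 1) => Fin n × Fin n) ((i, q), w)) = w := rfl
        rw [e]
        simp
        ring
      · intro b _ hb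
        simp [hb]
      · simp

lemma trace_expand (n m : ℕ) : ∃ coef : (Fin m → Fin n × Fin n) → ℝ,
    (∀ w, 0 ≤ coef w) ∧ ∀ A : Matrix (Fin n) (Fin n) ℝ,
      (A ^ m).trace = ∑ w, coef w * ∏ t, A (w t).1 (w t).2 := by
  choose coef h0 h using fun i => pow_expand n m i i
  refine ⟨fun w => ∑ i, coef i w, fun w => Finset.sum_nonneg fun i _ => h0 i w, fun A => ?_⟩
  simp_rw [Matrix.trace, Matrix.diag, h _ A, Finset.sum_mul]
  rw [Finset.sum_comm]

lemma trace_integrable {Ω : Type*} [MeasurableSpace Ω] {μ : Measure Ω} [IsProbabilityMeasure μ]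
    {n : ℕ} (m : ℕ) {X : Ω → Matrix (Fin n) (Fin n) ℝ}
    (hX : GV μ (fun (p : Fin n × Fin n) ω => X ω p.1 p.2)) :
    Integrable (fun ω => (X ω ^ m).trace) μ := by
  obtain ⟨coef, h0, h⟩ := trace_expand n m
  simp_rw [h]
  refine integrable_finsetSum _ fun w _ => Integrable.const_mul ?_ _
  exact wick_integrable (fun t ω => X ω (w t).1 (w t).2) (fun t => (hX.1 (w t)).aemeasurable)
    (fun S => hX.sub w S)

lemma trace_compare {Ω Ω' : Type*} [MeasurableSpace Ω] {μ : Measure Ω} [IsProbabilityMeasure μ]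
    [MeasurableSpace Ω'] {μ' : Measure Ω'} [IsProbabilityMeasure μ']
    {n : ℕ} (k : ℕ) {X : Ω → Matrix (Fin n) (Fin n) ℝ} {X' : Ω' → Matrix (Fin n) (Fin n) ℝ}
    (hX : GV μ (fun (p : Fin n × Fin n) ω => X ω p.1 p.2))
    (hX' : GV μ' (fun (p : Fin n × Fin n) ω => X' ω p.1 p.2))
    (hc : ∀ p q : Fin n × Fin n, |∫ ω, X ω p.1 p.2 * X ω q.1 q.2 ∂μ| ≤
      ∫ ω, X' ω p.1 p.2 * X' ω q.1 q.2 ∂μ') :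
    ∫ ω, (X ω ^ (2 * k)).trace ∂μ ≤ ∫ ω, (X' ω ^ (2 * k)).trace ∂μ' := by
  obtain ⟨coef, h0, h⟩ := trace_expand n (2 * k)
  simp_rw [h]
  rw [integral_finsetSum _ fun w _ => Integrable.const_mul
    (wick_integrable (fun t ω => X ω (w t).1 (w t).2) (fun t => (hX.1 (w t)).aemeasurable)
    (fun S => hX.sub w S)) _,
    integral_finsetSum _ fun w _ => Integrable.const_mul
    (wick_integrable (fun t ω => X' ω (w t).1 (w t).2) (fun t => (hX'.1 (w t)).aemeasurable)
    (fun S => hX'.sub w S)) _]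
  refine Finset.sum_le_sum fun w _ => ?_
  rw [integral_const_mul, integral_const_mul]
  refine mul_le_mul_of_nonneg_left ?_ (h0 w)
  have a1 := wick k (by simp) (fun t ω => X ω (w t).1 (w t).2) (fun t => (hX.1 (w t)).aemeasurable)
    (fun S => hX.sub w S)
  have a2 := wick k (by simp) (fun t ω => X' ω (w t).1 (w t).2) (fun t => (hX'.1 (w t)).aemeasurable)
    (fun S => hX'.sub w S)
  have hp : (0 : ℝ) < ((2 * k).factorial : ℕ) := by positivity
  refine le_of_mul_le_mul_left ?_ hp
  rw [a1, a2]
  refine mul_le_mul_of_nonneg_left ?_ (by positivity)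
  exact wickQ_mono _ _ _ fun i j => hc (w i) (w j)


/-! ### Operator norm in coordinates -/

section opn

open scoped Matrix.Norms.L2Operator

lemma l2_sq_le {n : ℕ} (A : Matrix (Fin n) (Fin n) ℝ) (x : Fin n → ℝ) :
    ∑ i, (A.mulVec x i) ^ 2 ≤ ‖A‖ ^ 2 * ∑ i, x i ^ 2 := by
  have h := Matrix.l2_opNorm_mulVec A (WithLp.toLp 2 x)
  have h2 := pow_le_pow_left₀ (norm_nonneg _) h 2
  rw [mul_pow, EuclideanSpace.real_norm_sq_eq, EuclideanSpace.real_norm_sq_eq] at h2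
  simpa using h2

lemma l2_le_of {n : ℕ} (A : Matrix (Fin n) (Fin n) ℝ) (b : ℝ) (hb : 0 ≤ b)
    (h : ∀ x : Fin n → ℝ, ∑ i, (A.mulVec x i) ^ 2 ≤ b ^ 2 * ∑ i, x i ^ 2) : ‖A‖ ≤ b := by
  rw [Matrix.l2_opNorm_def]
  refine ContinuousLinearMap.opNorm_le_bound _ hb fun x => ?_
  refine le_of_sq_le_sq ?_ (by positivity)
  rw [mul_pow, EuclideanSpace.real_norm_sq_eq, EuclideanSpace.real_norm_sq_eq]
  exact h x.ofLp

lemma l2_meas (n : ℕ) : Measurable (fun G : Fin n → Fin n → ℝ => ‖Matrix.of G‖) := by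
  have : Continuous (fun G : Fin n → Fin n → ℝ => ‖Matrix.of G‖) :=
    continuous_norm.comp (continuous_id)
  exact this.measurable

lemma l2_transpose {n : ℕ} (A : Matrix (Fin n) (Fin n) ℝ) : ‖A.transpose‖ = ‖A‖ := by
  have := Matrix.l2_opNorm_conjTranspose A
  rwa [Matrix.conjTranspose_eq_transpose_of_trivial] at this

lemma l2_pow {n : ℕ} (A : Matrix (Fin n) (Fin n) ℝ) (hA : A.IsSymm) (m : ℕ) :
    ‖A ^ (2 ^ m)‖ = ‖A‖ ^ (2 ^ m) := by
  have hs : IsSelfAdjoint A := by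
    rw [IsSelfAdjoint, Matrix.star_eq_conjTranspose, Matrix.conjTranspose_eq_transpose_of_trivial]
    exact hA
  have := hs.nnnorm_pow_two_pow m
  have := congrArg NNReal.toReal this
  simpa using this

/-- `‖A‖^2 ≤ ‖A‖_F^2` -/
lemma l2_le_frob {n : ℕ} (A : Matrix (Fin n) (Fin n) ℝ) :
    ‖A‖ ^ 2 ≤ ∑ i, ∑ j, A i j ^ 2 := by
  have h0 : 0 ≤ ∑ i, ∑ j, A i j ^ 2 := Finset.sum_nonneg fun i _ => Finset.sum_nonneg fun j _ => sq_nonneg _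
  have := l2_le_of A (√(∑ i, ∑ j, A i j ^ 2)) (Real.sqrt_nonneg _) (fun x => ?_)
  · exact (Real.le_sqrt (norm_nonneg _) h0).1 this
  · rw [Real.sq_sqrt h0, Finset.sum_mul]
    refine Finset.sum_le_sum fun i _ => ?_
    simp only [Matrix.mulVec, dotProduct]
    exact Finset.sum_mul_sq_le_sq_mul_sq _ _ _

lemma trace_sq {n : ℕ} (A : Matrix (Fin n) (Fin n) ℝ) (hA : A.IsSymm) :
    (A * A).trace = ∑ i, ∑ j, A i j ^ 2 := by
  simp only [Matrix.trace, Matrix.diag, Matrix.mul_apply]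
  refine Finset.sum_congr rfl fun i _ => Finset.sum_congr rfl fun j _ => ?_
  rw [hA.apply i j, sq]

lemma norm_pow_le_trace {n : ℕ} (A : Matrix (Fin n) (Fin n) ℝ) (hA : A.IsSymm) (m : ℕ) :
    ‖A‖ ^ (2 * 2 ^ m) ≤ (A ^ (2 * 2 ^ m)).trace := by
  rw [mul_comm, pow_mul, ← l2_pow A hA, mul_comm, two_mul, pow_add, trace_sq _ (hA.pow _)]
  exact l2_le_frob _

lemma frob_le {n : ℕ} (A : Matrix (Fin n) (Fin n) ℝ) :
    ∑ i, ∑ j, A i j ^ 2 ≤ n * ‖A‖ ^ 2 := by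
  rw [Finset.sum_comm]
  have : ∀ j, ∑ i, A i j ^ 2 ≤ ‖A‖ ^ 2 := by
    intro j
    have := l2_sq_le A (Pi.single j 1)
    simpa [Pi.single_apply] using this
  refine (Finset.sum_le_sum fun j _ => this j).trans ?_
  simp

lemma trace_le {n : ℕ} (A : Matrix (Fin n) (Fin n) ℝ) (hA : A.IsSymm) (k : ℕ) (hk : 1 ≤ k) :
    (A ^ (2 * k)).trace ≤ n * ‖A‖ ^ (2 * k) := by
  rw [two_mul, pow_add, trace_sq _ (hA.pow _)]
  refine (frob_le _).trans ?_
  have : ‖A ^ k‖ ^ 2 ≤ ‖A‖ ^ (k + k) := by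
    rw [← two_mul, mul_comm, pow_mul]
    exact pow_le_pow_left₀ (norm_nonneg _) (norm_pow_le' _ hk) 2
  exact mul_le_mul_of_nonneg_left this (by positivity)

end opn


/-! ### Moments of the norm of an iid Gaussian matrix -/

section goe

open scoped Matrix.Norms.L2Operator

lemma gauss_norm_moment {E : Type*} [MeasurableSpace E] (ν : Measure E) [IsProbabilityMeasure ν]
    (n k : ℕ) (f : E → ℝ) (s : ℝ) (hs : 0 < s)
    (hf : ∫ y, Real.exp (f y ^ 2 / (4 * s)) ∂ν = √2) :
    ∫⁻ y, ENNReal.ofReal ((∑ j : Fin n, f (y j) ^ 2) ^ k) ∂(Measure.pi (fun _ : Fin n => ν)) ≤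
      ENNReal.ofReal (k.factorial * (4 * s) ^ k * √2 ^ n) := by
  have hI := integral_fintype_prod_eq_pow (ι := Fin n) (μ := ν)
    (fun y => Real.exp (f y ^ 2 / (4 * s)))
  rw [hf, Fintype.card_fin] at hI
  have hintg : Integrable (fun y : Fin n → E => ∏ j, Real.exp (f (y j) ^ 2 / (4 * s)))
      (Measure.pi (fun _ : Fin n => ν)) := by
    by_contra hc
    rw [integral_undef hc] at hI
    have : 0 < √2 ^ n := by positivity
    linarith
  rw [← hI, ← integral_const_mul, ofReal_integral_eq_lintegral_ofReal (hintg.const_mul _)]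
  · refine lintegral_mono fun y => ENNReal.ofReal_le_ofReal ?_
    rw [← Real.exp_sum, ← Finset.sum_div]
    have h1 := Real.pow_div_factorial_le_exp (x := (∑ j : Fin n, f (y j) ^ 2) / (4 * s))
      (by positivity) k
    rw [div_le_iff₀ (by positivity), div_pow, div_le_iff₀ (by positivity)] at h1
    linarith
  · refine Eventually.of_forall fun y => ?_
    positivity

lemma gvec_norm_moment (n k : ℕ) :
    ∫⁻ x, ENNReal.ofReal ((∑ j : Fin n, x j ^ 2) ^ k) ∂(gvec n) ≤
      ENNReal.ofReal (k.factorial * 4 ^ k * √2 ^ n) := by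
  have := gauss_norm_moment (gaussianReal 0 1) n k (fun x => x) 1 one_pos (by simpa using gexp_std)
  simpa [gvec] using this

lemma gmat_mul_moment (n k : ℕ) (x : Fin n → ℝ) :
    ∫⁻ G, ENNReal.ofReal ((∑ i : Fin n, ((Matrix.of G).mulVec x i) ^ 2) ^ k) ∂(gmat n) ≤
      ENNReal.ofReal (k.factorial * 4 ^ k * √2 ^ n * (∑ j, x j ^ 2) ^ k) := by
  have hs0 : 0 ≤ ∑ j, x j ^ 2 := Finset.sum_nonneg fun j _ => sq_nonneg _
  rcases hs0.eq_or_lt with hs | hs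
  · have hx : x = 0 := by
      ext j
      have := (Finset.sum_eq_zero_iff_of_nonneg (fun j _ => sq_nonneg (x j))).1 hs.symm j (Finset.mem_univ j)
      simpa using this
    subst hx
    rcases Nat.eq_zero_or_pos k with rfl | hk
    · simp
      exact one_le_pow₀ (by rw [ENNReal.one_le_ofReal, Real.one_le_sqrt]; norm_num)
    · simp [hk.ne']
  · have := gauss_norm_moment (gvec n) n k (fun g => ∑ j, x j * g j) (∑ j, x j ^ 2) hs ?_
    · refine le_trans (le_of_eq ?_) (this.trans (le_of_eq ?_))
      · simp only [gmat, Matrix.mulVec, dotProduct, Matrix.of_apply]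
        simp_rw [mul_comm (x _)]
      · congr 1; rw [mul_pow]; ring
    · have h1 := gvec_lin n x
      have h2 := integral_map (μ := gvec n) (φ := fun g => ∑ j, x j * g j)
        (f := fun y => Real.exp (y ^ 2 / (4 * (∑ j, x j ^ 2))))
        (Measurable.aemeasurable (by fun_prop)) (by fun_prop)
      rw [← h2, h1]
      have h3 := gexp (∑ j, x j ^ 2).toNNReal (by simpa using hs)
      rwa [Real.coe_toNNReal _ hs0] at h3

open scoped Nat in
lemma norm_le_phi (n k : ℕ) (hk : 1 ≤ k) (A : Matrix (Fin n) (Fin n) ℝ) :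
    ENNReal.ofReal (((2 * k - 1 : ℕ)‼ : ℝ) * ‖A‖ ^ (2 * k)) ≤
      ∫⁻ x, ENNReal.ofReal ((∑ i : Fin n, (A.mulVec x i) ^ 2) ^ k) ∂(gvec n) := by
  set Φ := ∫⁻ x, ENNReal.ofReal ((∑ i : Fin n, (A.mulVec x i) ^ 2) ^ k) ∂(gvec n) with hΦ
  by_cases hT : Φ = ⊤
  · rw [hT]; exact le_top
  have hd : (0 : ℝ) < ((2 * k - 1 : ℕ)‼ : ℝ) := by exact_mod_cast Nat.doubleFactorial_pos _
  -- pointwise bound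
  have key : ∀ w : Fin n → ℝ, ((2 * k - 1 : ℕ)‼ : ℝ) * (∑ j, (A.transpose.mulVec w j) ^ 2) ^ k ≤
      (∑ j, w j ^ 2) ^ k * Φ.toReal := by
    intro w
    set c := A.transpose.mulVec w with hc
    have hlin : ∀ x : Fin n → ℝ, ∑ j, c j * x j = ∑ i, w i * A.mulVec x i := by
      intro x
      have := Matrix.dotProduct_mulVec w A x
      simp only [dotProduct] at this
      rw [this, hc, Matrix.mulVec_transpose]
    have h1 := gvec_lin n c
    have hm : AEMeasurable (fun x : Fin n → ℝ => ∑ j, c j * x j) (gvec n) := Measurable.aemeasurable (by fun_prop)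
    have h2 := int_gauss hm h1 k
    rw [gvec_lin_sq] at h2
    have hi := integrable_pow_of_gauss hm h1 (2 * k)
    have h3 := ofReal_integral_eq_lintegral_ofReal hi (Eventually.of_forall fun x => by
      simp only [Pi.zero_apply, pow_mul]; positivity)
    rw [h2] at h3
    have h4 : ∫⁻ x, ENNReal.ofReal ((∑ j, c j * x j) ^ (2 * k)) ∂(gvec n) ≤
        ENNReal.ofReal ((∑ j, w j ^ 2) ^ k) * Φ := by
      rw [hΦ, ← lintegral_const_mul' _ _ (by simp)]
      refine lintegral_mono fun x => ?_
      rw [← ENNReal.ofReal_mul (by positivity)]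
      refine ENNReal.ofReal_le_ofReal ?_
      rw [hlin, pow_mul, ← mul_pow]
      exact pow_le_pow_left₀ (sq_nonneg _) (Finset.sum_mul_sq_le_sq_mul_sq _ _ _) k
    rw [← h3] at h4
    have h5 := ENNReal.toReal_mono (ENNReal.mul_ne_top (by simp) hT) h4
    rw [ENNReal.toReal_mul, ENNReal.toReal_ofReal (by positivity), ENNReal.toReal_ofReal (by positivity)] at h5
    linarith
  set r : ℝ := Φ.toReal / ((2 * k - 1 : ℕ)‼ : ℝ) with hr
  have hr0 : 0 ≤ r := by positivity
  have hk0 : (2 * k) ≠ 0 := by omega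
  set b : ℝ := r ^ (((2 * k : ℕ) : ℝ)⁻¹) with hb
  have hb0 : 0 ≤ b := by positivity
  have hbp : b ^ (2 * k) = r := Real.rpow_inv_natCast_pow hr0 hk0
  have hn : ‖A‖ ≤ b := by
    rw [← l2_transpose]
    refine l2_le_of _ b hb0 fun w => ?_
    refine le_of_pow_le_pow_left₀ (n := k) (by omega) (by positivity) ?_
    rw [mul_pow, ← pow_mul, hbp, hr, div_mul_eq_mul_div, le_div_iff₀ hd]
    have := key w
    linarith
  have : ‖A‖ ^ (2 * k) ≤ r := hbp ▸ pow_le_pow_left₀ (norm_nonneg _) hn _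
  rw [hr, le_div_iff₀ hd] at this
  rw [← ENNReal.ofReal_toReal hT]
  exact ENNReal.ofReal_le_ofReal (by linarith)

open scoped Nat in
lemma fact_le_dfac (n : ℕ) : n.factorial ≤ (2 * n - 1)‼ := by
  induction n with
  | zero => simp
  | succ n ih =>
    rcases Nat.eq_zero_or_pos n with rfl | hn
    · simp
    have e : 2 * (n + 1) - 1 = (2 * n - 1) + 2 := by omega
    rw [e, Nat.doubleFactorial_add_two, Nat.factorial_succ]
    exact Nat.mul_le_mul (by omega) ih

open scoped Nat in
lemma dfac_le (n : ℕ) : (2 * n - 1)‼ ≤ (2 * n) ^ n := by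
  induction n with
  | zero => simp
  | succ n ih =>
    rcases Nat.eq_zero_or_pos n with rfl | hn
    · simp
    have e : 2 * (n + 1) - 1 = (2 * n - 1) + 2 := by omega
    rw [e, Nat.doubleFactorial_add_two, pow_succ, mul_comm]
    exact Nat.mul_le_mul (ih.trans (Nat.pow_le_pow_left (by omega) n)) (by omega)

lemma gmat_norm_moment (n : ℕ) (hn : 1 ≤ n) :
    ∫⁻ G, ENNReal.ofReal (‖Matrix.of G‖ ^ (2 * n)) ∂(gmat n) ≤ ENNReal.ofReal ((64 * n) ^ n) := by
  have hf : (0 : ℝ) < n.factorial := by positivity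
  have h1 : ENNReal.ofReal (n.factorial) * ∫⁻ G, ENNReal.ofReal (‖Matrix.of G‖ ^ (2 * n)) ∂(gmat n) ≤
      ENNReal.ofReal (n.factorial * 4 ^ n * √2 ^ n) * ENNReal.ofReal (n.factorial * 4 ^ n * √2 ^ n) := by
    rw [← lintegral_const_mul' _ _ (by simp)]
    calc ∫⁻ G, ENNReal.ofReal (n.factorial) * ENNReal.ofReal (‖Matrix.of G‖ ^ (2 * n)) ∂(gmat n)
        ≤ ∫⁻ G, ∫⁻ x, ENNReal.ofReal ((∑ i : Fin n, ((Matrix.of G).mulVec x i) ^ 2) ^ n) ∂(gvec n) ∂(gmat n) := by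
          refine lintegral_mono fun G => ?_
          refine le_trans ?_ (norm_le_phi n n hn (Matrix.of G))
          rw [← ENNReal.ofReal_mul hf.le]
          refine ENNReal.ofReal_le_ofReal (mul_le_mul_of_nonneg_right ?_ (by positivity))
          exact_mod_cast fact_le_dfac n
      _ = ∫⁻ x, ∫⁻ G, ENNReal.ofReal ((∑ i : Fin n, ((Matrix.of G).mulVec x i) ^ 2) ^ n) ∂(gmat n) ∂(gvec n) := by
          refine lintegral_lintegral_swap ?_
          simp only [Matrix.mulVec, dotProduct, Matrix.of_apply, Function.uncurry_def]
          fun_prop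
      _ ≤ ∫⁻ x, ENNReal.ofReal (n.factorial * 4 ^ n * √2 ^ n) * ENNReal.ofReal ((∑ j, x j ^ 2) ^ n) ∂(gvec n) := by
          refine lintegral_mono fun x => ?_
          rw [← ENNReal.ofReal_mul (by positivity)]
          exact gmat_mul_moment n n x
      _ ≤ _ := by
          rw [lintegral_const_mul' _ _ (by simp)]
          gcongr
          exact gvec_norm_moment n n
  have h2 : ENNReal.ofReal (n.factorial * 4 ^ n * √2 ^ n) * ENNReal.ofReal (n.factorial * 4 ^ n * √2 ^ n)
      = ENNReal.ofReal (n.factorial) * ENNReal.ofReal (n.factorial * 32 ^ n) := by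
    rw [← ENNReal.ofReal_mul (by positivity), ← ENNReal.ofReal_mul (by positivity)]
    congr 1
    have : (32 : ℝ) ^ n = 4 ^ n * 4 ^ n * (√2 ^ n * √2 ^ n) := by
      rw [← mul_pow, ← mul_pow, ← mul_pow, Real.mul_self_sqrt (by norm_num)]; norm_num
    rw [this]; ring
  rw [h2, ENNReal.mul_le_mul_iff_right (by simpa using Nat.factorial_ne_zero n) (by simp)] at h1
  refine h1.trans (ENNReal.ofReal_le_ofReal ?_)
  have h3 : (n.factorial : ℝ) ≤ (n : ℝ) ^ n := by exact_mod_cast Nat.factorial_le_pow n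
  have h4 : (32 : ℝ) ^ n ≤ 64 ^ n := pow_le_pow_left₀ (by norm_num) (by norm_num) n
  rw [mul_pow, mul_comm]
  exact mul_le_mul h4 h3 (by positivity) (by positivity)

end goe


/-! ### The comparison model -/

section model

open scoped Matrix.Norms.L2Operator

/-- comparison measure -/
noncomputable def cmeas (n : ℕ) : Measure ((Fin n → Fin n → ℝ) × ℝ) :=
  (gmat n).prod (gaussianReal 0 1)

instance (n : ℕ) : IsProbabilityMeasure (cmeas n) := by unfold cmeas; infer_instance
instance (n : ℕ) : IsGaussian (cmeas n) := by unfold cmeas; infer_instance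

/-- comparison matrix -/
def cmat (n : ℕ) (c : ℝ) (p : (Fin n → Fin n → ℝ) × ℝ) : Matrix (Fin n) (Fin n) ℝ :=
  Matrix.of fun i j => p.1 i j + p.1 j i + c * p.2

lemma gmat_row (n : ℕ) (i : Fin n) : (gmat n).map (fun G => G i) = gvec n :=
  (measurePreserving_eval (fun _ : Fin n => gvec n) i).map_eq

lemma gmat_int_row (n : ℕ) (i : Fin n) (f : (Fin n → ℝ) → ℝ) (hf : Measurable f) :
    ∫ G, f (G i) ∂(gmat n) = ∫ x, f x ∂(gvec n) := by
  have := integral_map (μ := gmat n) (φ := fun G => G i) (f := f) (measurable_pi_apply i).aemeasurable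
    hf.aestronglyMeasurable
  rw [← this, gmat_row]

lemma gmat_int (n : ℕ) (i j : Fin n) : ∫ G, G i j ∂(gmat n) = 0 := by
  rw [gmat_int_row n i (fun x => x j) (by fun_prop), gvec_int]

lemma gmat_int2 (n : ℕ) (i j k l : Fin n) :
    ∫ G, G i j * G k l ∂(gmat n) = if i = k ∧ j = l then 1 else 0 := by
  by_cases h : i = k
  · subst h
    rw [gmat_int_row n i (fun x => x j * x l) (by fun_prop), gvec_int2]
    simp
  · have hI : iIndepFun (fun i (ω : Fin n → Fin n → ℝ) => ω i) (gmat n) :=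
      iIndepFun_pi (X := fun i => id) (fun i => aemeasurable_id)
    have h2 := (hI.indepFun h).comp (measurable_pi_apply j) (measurable_pi_apply l)
    simp only [Function.comp_def] at h2
    have := h2.integral_fun_mul_eq_mul_integral
      (Measurable.aestronglyMeasurable (by fun_prop)) (Measurable.aestronglyMeasurable (by fun_prop))
    rw [this, gmat_int, zero_mul]
    simp [h]

lemma gmat_memLp (n : ℕ) (i j : Fin n) (p : ENNReal) (hp : p ≠ ⊤) :
    MemLp (fun x : Fin n → Fin n → ℝ => x i j) p (gmat n) :=
  IsGaussian.memLp_dual (gmat n) ((ContinuousLinearMap.proj (R := ℝ) (φ := fun _ : Fin n => ℝ) j).comp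
    (ContinuousLinearMap.proj (R := ℝ) (φ := fun _ : Fin n => (Fin n → ℝ)) i)) p hp

lemma g1_int2 : ∫ h, h * h ∂(gaussianReal 0 1) = 1 := by
  have := gm_std 1
  simpa [sq] using this

/-- functional for the entries -/
noncomputable def entL (n : ℕ) (c : ℝ) (i j : Fin n) : StrongDual ℝ ((Fin n → Fin n → ℝ) × ℝ) :=
  let E := fun i j : Fin n => ((ContinuousLinearMap.proj (R := ℝ) (φ := fun _ : Fin n => ℝ) j).comp
    (ContinuousLinearMap.proj (R := ℝ) (φ := fun _ : Fin n => (Fin n → ℝ)) i)).comp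
      (ContinuousLinearMap.fst ℝ (Fin n → Fin n → ℝ) ℝ)
  E i j + E j i + c • ContinuousLinearMap.snd ℝ (Fin n → Fin n → ℝ) ℝ

lemma entL_apply (n : ℕ) (c : ℝ) (i j : Fin n) (p) : entL n c i j p = cmat n c p i j := by
  simp [entL, cmat]

lemma gmat_intble (n : ℕ) (i j : Fin n) : Integrable (fun G : Fin n → Fin n → ℝ => G i j) (gmat n) :=
  (gmat_memLp n i j 1 (by simp)).integrable le_rfl

lemma gmat_intble2 (n : ℕ) (i j k l : Fin n) :
    Integrable (fun G : Fin n → Fin n → ℝ => G i j * G k l) (gmat n) :=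
  (gmat_memLp n i j 2 (by simp)).integrable_mul (gmat_memLp n k l 2 (by simp))

lemma g1_intble : Integrable (fun h : ℝ => h) (gaussianReal 0 1) :=
  (memLp_id_gaussianReal' (μ := 0) (v := 1) 1 (by simp)).integrable le_rfl

lemma g1_intble2 : Integrable (fun h : ℝ => h * h) (gaussianReal 0 1) :=
  (memLp_id_gaussianReal' (μ := 0) (v := 1) 2 (by simp)).integrable_mul
    (memLp_id_gaussianReal' (μ := 0) (v := 1) 2 (by simp))

lemma cmat_int (n : ℕ) (c : ℝ) (i j : Fin n) : ∫ p, cmat n c p i j ∂(cmeas n) = 0 := by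
  have h1 : ∀ i j : Fin n, Integrable (fun p : (Fin n → Fin n → ℝ) × ℝ => p.1 i j) (cmeas n) :=
    fun i j => (gmat_intble n i j).comp_fst _
  have h2 : Integrable (fun p : (Fin n → Fin n → ℝ) × ℝ => p.2) (cmeas n) := g1_intble.comp_snd _
  have e1 : ∀ i j : Fin n, ∫ p, p.1 i j ∂(cmeas n) = 0 := by
    intro i j
    have := integral_fun_fst (μ := gmat n) (ν := gaussianReal 0 1) (fun G => G i j)
    rw [cmeas, this, gmat_int]; simp
  have e2 : ∫ p, p.2 ∂(cmeas n) = 0 := by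
    have := integral_fun_snd (μ := gmat n) (ν := gaussianReal 0 1) (fun G => G)
    rw [cmeas, this]; simp
  simp only [cmat, Matrix.of_apply]
  rw [integral_add (by fun_prop) (h2.const_mul c), integral_add (h1 i j) (h1 j i),
    integral_const_mul, e1, e1, e2]
  simp

lemma cmat_GV (n : ℕ) (c : ℝ) :
    GV (cmeas n) (fun (q : Fin n × Fin n) p => cmat n c p q.1 q.2) := by
  constructor
  · intro q
    simp only [← entL_apply]
    fun_prop
  · intro a
    let L : StrongDual ℝ ((Fin n → Fin n → ℝ) × ℝ) := ∑ q : Fin n × Fin n, a q • entL n c q.1 q.2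
    have hL : ∀ p, L p = ∑ q : Fin n × Fin n, a q * cmat n c p q.1 q.2 := by
      intro p; simp [L, entL_apply]
    have h := IsGaussian.map_eq_gaussianReal (μ := cmeas n) L
    have hi : ∀ q : Fin n × Fin n, Integrable (fun p => cmat n c p q.1 q.2) (cmeas n) := by
      intro q
      simp only [← entL_apply]
      exact (IsGaussian.memLp_dual (cmeas n) _ 1 (by simp)).integrable le_rfl
    have h0 : ∫ x, L x ∂(cmeas n) = 0 := by
      simp_rw [hL]
      rw [integral_finsetSum _ fun i _ => (hi i).const_mul _]
      simp [integral_const_mul, cmat_int]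
    rw [h0] at h
    refine ⟨(Var[L; cmeas n]).toNNReal, ?_⟩
    · rw [← h]; congr 1; ext x; exact (hL x).symm

lemma cmat_cov (n : ℕ) (c : ℝ) (i j k l : Fin n) :
    ∫ p, cmat n c p i j * cmat n c p k l ∂(cmeas n) =
      2 * (if i = k ∧ j = l then 1 else 0) + 2 * (if i = l ∧ j = k then 1 else 0) + c ^ 2 := by
  have h1 : ∀ i j k l : Fin n, Integrable (fun p : (Fin n → Fin n → ℝ) × ℝ => p.1 i j * p.1 k l) (cmeas n) :=
    fun i j k l => (gmat_intble2 n i j k l).comp_fst _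
  have h2 : Integrable (fun p : (Fin n → Fin n → ℝ) × ℝ => p.2 * p.2) (cmeas n) := g1_intble2.comp_snd _
  have h3 : ∀ i j : Fin n, Integrable (fun p : (Fin n → Fin n → ℝ) × ℝ => p.1 i j * p.2) (cmeas n) :=
    fun i j => (gmat_intble n i j).mul_prod g1_intble
  have e1 : ∀ i j k l : Fin n, ∫ p, p.1 i j * p.1 k l ∂(cmeas n) = if i = k ∧ j = l then 1 else 0 := by
    intro i j k l
    have := integral_fun_fst (μ := gmat n) (ν := gaussianReal 0 1) (fun G => G i j * G k l)
    rw [cmeas, this, gmat_int2]; simp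
  have e2 : ∫ p, p.2 * p.2 ∂(cmeas n) = 1 := by
    have := integral_fun_snd (μ := gmat n) (ν := gaussianReal 0 1) (fun h => h * h)
    rw [cmeas, this, g1_int2]; simp
  have e3 : ∀ i j : Fin n, ∫ p, p.1 i j * p.2 ∂(cmeas n) = 0 := by
    intro i j
    have := integral_prod_mul (μ := gmat n) (ν := gaussianReal 0 1) (fun G => G i j) (fun h => h)
    rw [cmeas, this, gmat_int]; simp
  have expand : ∀ p : (Fin n → Fin n → ℝ) × ℝ, cmat n c p i j * cmat n c p k l =
      p.1 i j * p.1 k l + p.1 i j * p.1 l k + p.1 j i * p.1 k l + p.1 j i * p.1 l k +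
      (c * (p.1 i j * p.2) + c * (p.1 j i * p.2) + c * (p.1 k l * p.2) + c * (p.1 l k * p.2)) +
      c ^ 2 * (p.2 * p.2) := by
    intro p; simp only [cmat, Matrix.of_apply]; ring
  simp_rw [expand]
  rw [integral_add (by fun_prop) (by fun_prop), integral_add (by fun_prop) (by fun_prop),
    integral_add (by fun_prop) (by fun_prop), integral_add (by fun_prop) (by fun_prop),
    integral_add (by fun_prop) (by fun_prop), integral_add (by fun_prop) (by fun_prop),
    integral_add (by fun_prop) (by fun_prop), integral_add (by fun_prop) (by fun_prop)]
  simp only [integral_const_mul, e1, e2, e3]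
  simp only [and_comm (a := j = k), and_comm (a := j = l)]
  ring

end model


/-! ### Moment and tail bounds for the operator norm -/

section tail

open scoped Matrix.Norms.L2Operator

lemma cmat_symm (n : ℕ) (c : ℝ) (p) : (cmat n c p).IsSymm := by
  ext i j
  simp only [cmat, Matrix.transpose_apply, Matrix.of_apply]
  ring

lemma ones_norm (n : ℕ) : ‖(Matrix.of fun _ _ => 1 : Matrix (Fin n) (Fin n) ℝ)‖ ≤ n := by
  have := l2_le_frob (Matrix.of fun _ _ => 1 : Matrix (Fin n) (Fin n) ℝ)
  simp only [Matrix.of_apply, one_pow, Finset.sum_const, Finset.card_univ, Fintype.card_fin,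
    nsmul_eq_mul, mul_one, ← sq] at this
  exact le_of_sq_le_sq this (by positivity)

lemma cmat_norm (n : ℕ) (c : ℝ) (p) :
    ‖cmat n c p‖ ≤ 2 * ‖Matrix.of p.1‖ + |c| * n * |p.2| := by
  have e : cmat n c p = Matrix.of p.1 + (Matrix.of p.1).transpose +
      (c * p.2) • (Matrix.of fun _ _ => 1 : Matrix (Fin n) (Fin n) ℝ) := by
    ext i j; simp [cmat]
  rw [e]
  refine (norm_add_le _ _).trans ?_
  refine add_le_add ((norm_add_le _ _).trans ?_) ?_
  · rw [l2_transpose, two_mul]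
  · rw [norm_smul, Real.norm_eq_abs, abs_mul]
    have := mul_le_mul_of_nonneg_left (ones_norm n) (by positivity : 0 ≤ |c| * |p.2|)
    linarith

lemma cmat_trace_moment (n k : ℕ) (hk : 1 ≤ k) (hkn : k ≤ n) (c : ℝ)
    (hc : c ^ 2 * n * (2 * k) ≤ 1) :
    ∫ p, (cmat n c p ^ (2 * k)).trace ∂(cmeas n) ≤ 3 * n * 1024 ^ k * n ^ k := by
  have hn : 1 ≤ n := hk.trans hkn
  have hn0 : (0 : ℝ) < n := by exact_mod_cast hn
  have hintg := trace_integrable (2 * k) (cmat_GV n c)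
  have hnn : ∀ p, 0 ≤ (cmat n c p ^ (2 * k)).trace := by
    intro p
    rw [two_mul, pow_add, trace_sq _ ((cmat_symm n c p).pow _)]
    positivity
  -- pointwise bound
  have hpt : ∀ p, (cmat n c p ^ (2 * k)).trace ≤
      n * 4 ^ k * (256 ^ k * n ^ k) + n * 4 ^ k * (256 ^ k * n ^ k) / (64 * n) ^ n * ‖Matrix.of p.1‖ ^ (2 * n) +
      n * 4 ^ k * (c ^ 2 * n ^ 2) ^ k * p.2 ^ (2 * k) := by
    intro p
    have h1 := trace_le _ (cmat_symm n c p) k hk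
    have h2 := pow_le_pow_left₀ (norm_nonneg _) (cmat_norm n c p) (2 * k)
    set a := 2 * ‖Matrix.of p.1‖ with ha
    set b := |c| * n * |p.2| with hb
    have ha0 : 0 ≤ a := by positivity
    have hb0 : 0 ≤ b := by positivity
    have h3 : (a + b) ^ (2 * k) ≤ 4 ^ k * (a ^ (2 * k) + b ^ (2 * k)) := by
      have h := add_pow_le ha0 hb0 (2 * k)
      refine h.trans ?_
      refine mul_le_mul_of_nonneg_right ?_ (by positivity)
      rw [show (4 : ℝ) = 2 ^ 2 by norm_num, ← pow_mul]
      exact pow_le_pow_right₀ (by norm_num) (by omega)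
    have h4 : b ^ (2 * k) = (c ^ 2 * n ^ 2) ^ k * p.2 ^ (2 * k) := by
      have e : (|c| * n * |p.2|) ^ 2 = c ^ 2 * n ^ 2 * p.2 ^ 2 := by rw [mul_pow, mul_pow, sq_abs, sq_abs]
      rw [hb, pow_mul, e, mul_pow, ← pow_mul]
    have h5 : a ^ (2 * k) ≤ 256 ^ k * n ^ k * (1 + ‖Matrix.of p.1‖ ^ (2 * n) / (64 * n) ^ n) := by
      set s := ‖Matrix.of p.1‖ ^ 2 / (64 * n) with hs
      have hs0 : 0 ≤ s := by positivity
      have e1 : a ^ (2 * k) = 256 ^ k * n ^ k * s ^ k := by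
        rw [ha, hs, pow_mul, ← mul_pow, ← mul_pow]
        congr 1
        field_simp; ring
      have e2 : ‖Matrix.of p.1‖ ^ (2 * n) / (64 * n) ^ n = s ^ n := by
        rw [hs, div_pow, pow_mul]
      rw [e1, e2]
      refine mul_le_mul_of_nonneg_left ?_ (by positivity)
      rcases le_total s 1 with h | h
      · have := pow_le_one₀ hs0 h (n := k)
        have := pow_nonneg hs0 n
        linarith
      · have := pow_le_pow_right₀ h hkn
        linarith
    calc (cmat n c p ^ (2 * k)).trace ≤ n * ‖cmat n c p‖ ^ (2 * k) := h1
      _ ≤ n * (4 ^ k * (a ^ (2 * k) + b ^ (2 * k))) := by gcongr; exact h2.trans h3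
      _ ≤ n * (4 ^ k * (256 ^ k * n ^ k * (1 + ‖Matrix.of p.1‖ ^ (2 * n) / (64 * n) ^ n) +
          (c ^ 2 * n ^ 2) ^ k * p.2 ^ (2 * k))) := by rw [h4]; gcongr
      _ = _ := by ring
  set K1 : ℝ := n * 4 ^ k * (256 ^ k * n ^ k) with hK1
  set K2 : ℝ := n * 4 ^ k * (c ^ 2 * n ^ 2) ^ k with hK2
  have hK10 : 0 ≤ K1 := by positivity
  have hK20 : 0 ≤ K2 := by positivity
  have hfin : ENNReal.ofReal (∫ p, (cmat n c p ^ (2 * k)).trace ∂(cmeas n)) ≤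
      ENNReal.ofReal (K1 + K1 + K2 * (2 * k) ^ k) := by
    rw [ofReal_integral_eq_lintegral_ofReal hintg (Eventually.of_forall hnn)]
    have mG : Measurable (fun p : (Fin n → Fin n → ℝ) × ℝ => ‖Matrix.of p.1‖) :=
      (l2_meas n).comp measurable_fst
    calc ∫⁻ p, ENNReal.ofReal ((cmat n c p ^ (2 * k)).trace) ∂(cmeas n)
        ≤ ∫⁻ p, (ENNReal.ofReal K1 + ENNReal.ofReal (K1 / (64 * n) ^ n) * ENNReal.ofReal (‖Matrix.of p.1‖ ^ (2 * n)) +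
            ENNReal.ofReal K2 * ENNReal.ofReal (p.2 ^ (2 * k))) ∂(cmeas n) := by
          refine lintegral_mono fun p => ?_
          have hp2 : 0 ≤ p.2 ^ (2 * k) := by rw [pow_mul]; positivity
          rw [← ENNReal.ofReal_mul (by positivity), ← ENNReal.ofReal_mul (by positivity),
            ← ENNReal.ofReal_add (by positivity) (by positivity),
            ← ENNReal.ofReal_add (by positivity) (by positivity)]
          exact ENNReal.ofReal_le_ofReal (hpt p)
      _ = ENNReal.ofReal K1 + ENNReal.ofReal (K1 / (64 * n) ^ n) * ∫⁻ p, ENNReal.ofReal (‖Matrix.of p.1‖ ^ (2 * n)) ∂(cmeas n) +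
            ENNReal.ofReal K2 * ∫⁻ p, ENNReal.ofReal (p.2 ^ (2 * k)) ∂(cmeas n) := by
          rw [lintegral_add_left (by fun_prop), lintegral_add_left (by fun_prop),
            lintegral_const_mul' _ _ (by simp), lintegral_const_mul' _ _ (by simp)]
          simp
      _ ≤ ENNReal.ofReal K1 + ENNReal.ofReal (K1 / (64 * n) ^ n) * ENNReal.ofReal ((64 * n) ^ n) +
            ENNReal.ofReal K2 * ENNReal.ofReal ((2 * k) ^ k) := by
          have a1 : ∫⁻ p, ENNReal.ofReal (‖Matrix.of p.1‖ ^ (2 * n)) ∂(cmeas n) ≤ ENNReal.ofReal ((64 * n) ^ n) := by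
            refine le_trans (le_of_eq ?_) (gmat_norm_moment n hn)
            rw [cmeas, lintegral_prod _ (Measurable.aemeasurable (by fun_prop))]
            simp
          have a2 : ∫⁻ p, ENNReal.ofReal (p.2 ^ (2 * k)) ∂(cmeas n) ≤ ENNReal.ofReal ((2 * k) ^ k) := by
            rw [cmeas, lintegral_prod _ (Measurable.aemeasurable (by fun_prop))]
            simp only [lintegral_const, measure_univ, mul_one]
            have hi : Integrable (fun x : ℝ => x ^ (2 * k)) (gaussianReal 0 1) :=
              integrable_pow_of_gauss (Z := fun x : ℝ => x) (v := 1) (by fun_prop) (by simp) (2 * k)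
            rw [← ofReal_integral_eq_lintegral_ofReal hi (Eventually.of_forall fun x => by
              simp only [Pi.zero_apply, pow_mul]; positivity), gm_std]
            refine ENNReal.ofReal_le_ofReal ?_
            exact_mod_cast dfac_le k
          gcongr
      _ = ENNReal.ofReal (K1 + K1 + K2 * (2 * k) ^ k) := by
          rw [← ENNReal.ofReal_mul (by positivity), ← ENNReal.ofReal_mul (by positivity),
            ← ENNReal.ofReal_add (by positivity) (by positivity),
            ← ENNReal.ofReal_add (by positivity) (by positivity)]
          congr 2
          field_simp
  have h6 := (ENNReal.ofReal_le_ofReal_iff (by positivity)).1 hfin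
  refine h6.trans ?_
  have h7 : K2 * (2 * k) ^ k ≤ n * 4 ^ k * n ^ k := by
    rw [hK2, mul_assoc, ← mul_pow]
    refine mul_le_mul_of_nonneg_left ?_ (by positivity)
    refine pow_le_pow_left₀ (by positivity) ?_ k
    calc c ^ 2 * (n : ℝ) ^ 2 * (2 * k) = (n : ℝ) * (c ^ 2 * n * (2 * k)) := by ring
      _ ≤ (n : ℝ) * 1 := by gcongr
      _ = (n : ℝ) := mul_one _
  have h8 : (1024 : ℝ) ^ k = 4 ^ k * 256 ^ k := by rw [← mul_pow]; norm_num
  have h9 : (1 : ℝ) ≤ 256 ^ k := one_le_pow₀ (by norm_num)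
  have h10 : (n : ℝ) * 4 ^ k * n ^ k ≤ K1 := by
    rw [hK1]
    have : (n : ℝ) * 4 ^ k * (1 * n ^ k) ≤ n * 4 ^ k * (256 ^ k * n ^ k) := by gcongr
    linarith
  have h11 : 3 * (n : ℝ) * 1024 ^ k * n ^ k = K1 + K1 + K1 := by rw [hK1, h8]; ring
  linarith

lemma trace_moment {Ω : Type*} [MeasurableSpace Ω] {μ : Measure Ω} [IsProbabilityMeasure μ]
    (n k : ℕ) (hk : 1 ≤ k) (hkn : k ≤ n) {X : Ω → Matrix (Fin n) (Fin n) ℝ}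
    (hX : GV μ (fun (p : Fin n × Fin n) ω => X ω p.1 p.2)) (hs : ∀ ω, (X ω).IsSymm)
    (hv : ∀ i j, ∫ ω, (X ω i j) ^ 2 ∂μ = 1) (κ : ℝ) (hκ : 0 ≤ κ)
    (hcor : ∀ i j i' j' : Fin n, ¬((i, j) = (i', j') ∨ (i, j) = (j', i')) →
      |∫ ω, X ω i j * X ω i' j' ∂μ| ≤ κ)
    (hc : κ * n * (2 * k) ≤ 1) :
    ∫ ω, (X ω ^ (2 * k)).trace ∂μ ≤ 3 * n * 1024 ^ k * n ^ k := by
  have hsq : √κ ^ 2 = κ := Real.sq_sqrt hκ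
  refine (trace_compare k hX (cmat_GV n (√κ)) ?_).trans (cmat_trace_moment n k hk hkn (√κ) (by rwa [hsq]))
  rintro ⟨i, j⟩ ⟨i', j'⟩
  simp only [cmat_cov, hsq]
  by_cases h : (i, j) = (i', j') ∨ (i, j) = (j', i')
  · have e : ∫ ω, X ω i j * X ω i' j' ∂μ = 1 := by
      rw [← hv i j]
      congr 1; ext ω
      rcases h with h | h
      · obtain ⟨rfl, rfl⟩ := Prod.mk.inj h
        rw [sq]
      · obtain ⟨rfl, rfl⟩ := Prod.mk.inj h
        rw [(hs ω).apply i j, sq]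
    rw [e, abs_one]
    simp only [Prod.mk.injEq] at h
    rcases h with h | h
    · rw [if_pos h]
      split_ifs <;> linarith
    · rw [if_pos h]
      split_ifs <;> linarith
  · refine (hcor i j i' j' h).trans ?_
    simp only [Prod.mk.injEq, not_or] at h
    rw [if_neg h.1, if_neg h.2]
    linarith

lemma norm_tail {Ω : Type*} [MeasurableSpace Ω] {μ : Measure Ω} [IsProbabilityMeasure μ]
    (n m : ℕ) (hkn : 2 ^ m ≤ n) (hnk : n ≤ 4 ^ (2 ^ m)) {X : Ω → Matrix (Fin n) (Fin n) ℝ}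
    (hX : GV μ (fun (p : Fin n × Fin n) ω => X ω p.1 p.2)) (hs : ∀ ω, (X ω).IsSymm)
    (hv : ∀ i j, ∫ ω, (X ω i j) ^ 2 ∂μ = 1) (κ : ℝ) (hκ : 0 ≤ κ)
    (hcor : ∀ i j i' j' : Fin n, ¬((i, j) = (i', j') ∨ (i, j) = (j', i')) →
      |∫ ω, X ω i j * X ω i' j' ∂μ| ≤ κ)
    (hc : κ * n * (2 * 2 ^ m) ≤ 1) (M : ℝ) (hM : 64 ≤ M) :
    (μ {ω | M < ‖(√(n : ℝ))⁻¹ • X ω‖}).toReal ≤ 192 / M := by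
  have hk1 : 1 ≤ 2 ^ m := Nat.one_le_two_pow
  have hn0 : (0 : ℝ) < n := by exact_mod_cast (hk1.trans hkn)
  have hmom := trace_moment n (2 ^ m) hk1 hkn hX hs hv κ hκ hcor (by exact_mod_cast hc)
  have hintg := trace_integrable (2 * 2 ^ m) hX
  have hM0 : 0 < M := by linarith
  set k := 2 ^ m with hk
  have hnn : ∀ ω, 0 ≤ (X ω ^ (2 * k)).trace := fun ω =>
    le_trans (by positivity) (norm_pow_le_trace (X ω) (hs ω) m)
  have hmk := mul_meas_ge_le_integral_of_nonneg (Eventually.of_forall hnn) hintg ((M ^ 2 * n) ^ k)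
  have hsub : {ω | M < ‖(√(n : ℝ))⁻¹ • X ω‖} ⊆ {ω | (M ^ 2 * n) ^ k ≤ (X ω ^ (2 * k)).trace} := by
    intro ω hω
    simp only [Set.mem_ofPred_eq] at hω ⊢
    refine le_trans ?_ (norm_pow_le_trace (X ω) (hs ω) m)
    rw [pow_mul]
    refine pow_le_pow_left₀ (by positivity) ?_ k
    rw [norm_smul, norm_inv, Real.norm_of_nonneg (Real.sqrt_nonneg _), inv_mul_eq_div,
      lt_div_iff₀ (by positivity)] at hω
    have := pow_le_pow_left₀ (by positivity) hω.le 2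
    rwa [mul_pow, Real.sq_sqrt hn0.le] at this
  have h1 : (μ {ω | M < ‖(√(n : ℝ))⁻¹ • X ω‖}).toReal ≤
      μ.real {ω | (M ^ 2 * n) ^ k ≤ (X ω ^ (2 * k)).trace} :=
    ENNReal.toReal_mono (measure_ne_top _ _) (measure_mono hsub)
  have hpos : 0 < (M ^ 2 * n) ^ k := by positivity
  have h2 : μ.real {ω | (M ^ 2 * n) ^ k ≤ (X ω ^ (2 * k)).trace} ≤
      3 * n * 1024 ^ k * n ^ k / (M ^ 2 * n) ^ k := by
    rw [le_div_iff₀ hpos]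
    linarith
  refine h1.trans (h2.trans ?_)
  have hn4 : (n : ℝ) ≤ 4 ^ k := by exact_mod_cast hnk
  calc 3 * (n : ℝ) * 1024 ^ k * n ^ k / (M ^ 2 * n) ^ k
      = 3 * (n * 1024 ^ k) / (M ^ 2) ^ k := by rw [mul_pow]; field_simp
    _ ≤ 3 * (4 ^ k * 1024 ^ k) / (M ^ 2) ^ k := by gcongr
    _ = 3 * ((64 / M) ^ (2 * k)) := by
        rw [div_pow, pow_mul, pow_mul, ← mul_pow]; norm_num; ring
    _ ≤ 3 * (64 / M) := by
        gcongr
        refine pow_le_of_le_one (by positivity) ?_ (by omega)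
        rw [div_le_one hM0]; exact hM
    _ = 192 / M := by ring

end tail


/-! ### Deterministic perturbation bound -/

section det

lemma det_abs {E : Type*} [NormedAddCommGroup E] [InnerProductSpace ℝ E] (T : E →ₗ[ℝ] E)
    (hT : T.IsSymmetric) (w : ℝ) (hw : 0 ≤ w) (hTw : ∀ x, ‖T x‖ ≤ w * ‖x‖) (u : E) (hu : ‖u‖ = 1)
    (l μ : ℝ) (hl : 0 < l) (v : E) (hv : v ≠ 0)
    (hev : T v + (l * inner ℝ u v) • u = μ • v)
    (hR : inner ℝ u (T u) + l ≤ μ) :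
    |μ - l - inner ℝ u (T u) - (‖T u‖ ^ 2 - (inner ℝ u (T u)) ^ 2) / l| ≤ 36 * w ^ 3 / l ^ 2 := by
  set a := inner ℝ u (T u) with ha
  have hTu : ‖T u‖ ≤ w := by simpa [hu] using hTw u
  have habs : |a| ≤ w := by
    have := abs_real_inner_le_norm u (T u)
    rw [hu, one_mul] at this
    exact this.trans hTu
  have ha2 : |a| ≤ ‖T u‖ := by
    have := abs_real_inner_le_norm u (T u)
    rwa [hu, one_mul] at this
  have hvp : 0 < ‖v‖ := norm_pos_iff.2 hv
  have huu : inner ℝ u u = (1 : ℝ) := by rw [real_inner_self_eq_norm_sq, hu]; norm_num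
  have hq0 : 0 ≤ ‖T u‖ ^ 2 - a ^ 2 := by
    have := pow_le_pow_left₀ (abs_nonneg _) ha2 2
    rw [sq_abs] at this; linarith
  have hq1 : ‖T u‖ ^ 2 - a ^ 2 ≤ w ^ 2 := by
    have := pow_le_pow_left₀ (norm_nonneg _) hTu 2
    nlinarith [sq_nonneg a]
  have ha' := abs_le.1 habs
  rcases le_or_gt l (4 * w) with hc | hc
  · -- crude case
    have hμ : μ ≤ l + w := by
      have h1 := congrArg (fun y => inner ℝ v y) hev
      simp only [inner_add_right, inner_smul_right, real_inner_self_eq_norm_sq] at h1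
      have h2 : inner ℝ v (T v) ≤ w * ‖v‖ ^ 2 := by
        refine (real_inner_le_norm _ _).trans ?_
        have := mul_le_mul_of_nonneg_left (hTw v) (norm_nonneg v)
        linarith
      have h3 : inner ℝ u v * inner ℝ v u ≤ ‖v‖ ^ 2 := by
        rw [real_inner_comm u v]
        have := abs_real_inner_le_norm u v
        rw [hu, one_mul] at this
        have := pow_le_pow_left₀ (abs_nonneg _) this 2
        rw [sq_abs] at this
        rw [real_inner_comm v u] at *
        nlinarith
      have h4 : l * (inner ℝ u v * inner ℝ v u) ≤ l * ‖v‖ ^ 2 := mul_le_mul_of_nonneg_left h3 hl.le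
      have h5 : μ * ‖v‖ ^ 2 ≤ (l + w) * ‖v‖ ^ 2 := by nlinarith
      exact le_of_mul_le_mul_right h5 (by positivity)
    have hwl : 0 < w := by linarith
    have e1 : |μ - l - a| ≤ 2 * w := by
      rw [abs_le]; constructor <;> linarith
    have e2 : |(‖T u‖ ^ 2 - a ^ 2) / l| ≤ w ^ 2 / l := by
      rw [abs_of_nonneg (by positivity)]; gcongr
    have e3 := abs_sub (μ - l - a) ((‖T u‖ ^ 2 - a ^ 2) / l)
    refine e3.trans ((add_le_add e1 e2).trans ?_)
    rw [le_div_iff₀ (by positivity)]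
    have e4 : (2 * w + w ^ 2 / l) * l ^ 2 = 2 * w * l ^ 2 + w ^ 2 * l := by field_simp
    rw [e4]
    have e5 : l ^ 2 ≤ (4 * w) ^ 2 := pow_le_pow_left₀ hl.le hc 2
    nlinarith [mul_le_mul_of_nonneg_left e5 hwl.le, mul_le_mul_of_nonneg_left hc (sq_nonneg w)]
  · -- main case
    have hμl : l - w ≤ μ := by linarith
    have hs : inner ℝ u v ≠ (0 : ℝ) := by
      intro h0
      rw [h0, mul_zero, zero_smul, add_zero] at hev
      have h1 := hTw v
      rw [hev, norm_smul, Real.norm_eq_abs] at h1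
      have h2 := le_of_mul_le_mul_right h1 hvp
      have := le_abs_self μ
      linarith
    set s : ℝ := inner ℝ u v with hsdef
    obtain ⟨z, hz⟩ : ∃ z, z = s⁻¹ • v - u := ⟨_, rfl⟩
    have hvz : v = s • (u + z) := by
      rw [hz, add_sub_cancel, smul_smul, mul_inv_cancel₀ hs, one_smul]
    have huz : inner ℝ u z = (0 : ℝ) := by
      rw [hz, inner_sub_right, inner_smul_right, ← hsdef, huu, inv_mul_cancel₀ hs, sub_self]
    have hzu : inner ℝ z u = (0 : ℝ) := by rw [real_inner_comm]; exact huz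
    have hE : T u + T z + l • u = μ • (u + z) := by
      have h1 : s • (T u + T z + l • u) = s • (μ • (u + z)) := by
        have h2 : T v = s • (T u + T z) := by
          conv_lhs => rw [hvz]
          rw [map_smul, map_add]
        have h3 : μ • v = s • μ • (u + z) := by
          conv_lhs => rw [hvz]
          rw [smul_comm]
        rw [h2, h3] at hev
        rw [← hev, smul_add s (T u + T z), smul_smul, mul_comm l s]
      exact smul_right_injective E hs h1
    set b := inner ℝ (T u) z with hb
    have hb2 : inner ℝ u (T z) = b := by rw [hb, hT u z]
    have i1 : a + b + l = μ := by
      have h1 := congrArg (fun y => inner ℝ u y) hE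
      simp only [inner_add_right, inner_smul_right, huz, huu, hb2] at h1
      linarith
    have i2 : b + inner ℝ z (T z) = μ * ‖z‖ ^ 2 := by
      have h1 := congrArg (fun y => inner ℝ z y) hE
      simp only [inner_add_right, inner_smul_right, hzu, real_inner_self_eq_norm_sq] at h1
      rw [hb, real_inner_comm]
      linarith
    have i3 : ‖T u‖ ^ 2 + inner ℝ (T u) (T z) + l * a = μ * (a + b) := by
      have h1 := congrArg (fun y => inner ℝ (T u) y) hE
      simp only [inner_add_right, inner_smul_right, real_inner_self_eq_norm_sq] at h1
      rw [real_inner_comm u (T u)] at h1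
      linarith
    have hbz : |b| ≤ w * ‖z‖ :=
      (abs_real_inner_le_norm _ _).trans (mul_le_mul_of_nonneg_right hTu (norm_nonneg _))
    have hzn : ‖z‖ ≤ 2 * w / l := by
      rw [le_div_iff₀ hl]
      rcases (norm_nonneg z).eq_or_lt with h0 | h0
      · rw [← h0]; linarith
      have h1 : inner ℝ z (T z) ≤ w * ‖z‖ ^ 2 := by
        refine (real_inner_le_norm _ _).trans ?_
        have := mul_le_mul_of_nonneg_left (hTw z) (norm_nonneg z)
        linarith
      have h2 : (l / 2 * ‖z‖) * ‖z‖ ≤ w * ‖z‖ := by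
        have h3 : l / 2 ≤ μ - w := by linarith
        have h4 := mul_le_mul_of_nonneg_right h3 (sq_nonneg ‖z‖)
        have := le_abs_self b
        nlinarith
      have := le_of_mul_le_mul_right h2 h0
      linarith
    have key : l * (μ - l - a - (‖T u‖ ^ 2 - a ^ 2) / l) = inner ℝ (T u) (T z) - 2 * a * b - b ^ 2 := by
      have : l * (μ - l - a - (‖T u‖ ^ 2 - a ^ 2) / l) = l * (μ - l - a) - (‖T u‖ ^ 2 - a ^ 2) := by
        field_simp
      rw [this]
      subst i1
      nlinarith
    have hb3 : |b| ≤ 2 * w ^ 2 / l := by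
      refine hbz.trans ((mul_le_mul_of_nonneg_left hzn hw).trans (le_of_eq (by ring)))
    have j1 : |inner ℝ (T u) (T z)| ≤ 2 * w ^ 3 / l := by
      refine (abs_real_inner_le_norm _ _).trans ?_
      calc ‖T u‖ * ‖T z‖ ≤ w * (w * (2 * w / l)) := by
            refine mul_le_mul hTu ((hTw z).trans (mul_le_mul_of_nonneg_left hzn hw)) (norm_nonneg _) hw
        _ = _ := by ring
    have j2 : |2 * a * b| ≤ 4 * w ^ 3 / l := by
      rw [abs_mul, abs_mul, abs_two]
      calc 2 * |a| * |b| ≤ 2 * w * (2 * w ^ 2 / l) := by gcongr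
        _ = _ := by ring
    have j3 : |b ^ 2| ≤ w ^ 3 / l := by
      rw [abs_pow]
      calc |b| ^ 2 ≤ (2 * w ^ 2 / l) ^ 2 := by gcongr
        _ = (w ^ 3 / l) * (4 * w / l) := by ring
        _ ≤ (w ^ 3 / l) * 1 := by
            gcongr
            rw [div_le_one hl]; exact hc.le
        _ = _ := mul_one _
    have j4 : |l * (μ - l - a - (‖T u‖ ^ 2 - a ^ 2) / l)| ≤ 36 * w ^ 3 / l := by
      rw [key]
      have t1 := abs_sub (inner ℝ (T u) (T z) - 2 * a * b) (b ^ 2)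
      have t2 := abs_sub (inner ℝ (T u) (T z)) (2 * a * b)
      have t3 : 36 * w ^ 3 / l = 2 * w ^ 3 / l + 4 * w ^ 3 / l + w ^ 3 / l + 29 * (w ^ 3 / l) := by ring
      have t4 : 0 ≤ w ^ 3 / l := by positivity
      linarith
    rw [abs_mul, abs_of_pos hl] at j4
    have t5 : 36 * w ^ 3 / l ^ 2 = (36 * w ^ 3 / l) / l := by field_simp
    rw [t5, le_div_iff₀ hl]
    linarith

end det


section det2

open scoped Matrix.Norms.L2Operator

lemma toEuc_inner {n : ℕ} (x y : Fin n → ℝ) :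
    inner ℝ (WithLp.toLp 2 x) (WithLp.toLp 2 y) = ∑ i, x i * y i := by
  simp [PiLp.inner_apply, mul_comm]

lemma toEuc_symm {n : ℕ} (A : Matrix (Fin n) (Fin n) ℝ) (hA : A.IsSymm) :
    (Matrix.toEuclideanLin A).IsSymmetric := by
  rw [Matrix.isSymmetric_toEuclideanLin_iff]
  rw [Matrix.IsHermitian, Matrix.conjTranspose_eq_transpose_of_trivial]
  exact hA

lemma lam1_spec {n : ℕ} (hn : 1 ≤ n) (A : Matrix (Fin n) (Fin n) ℝ) (hA : A.IsSymm) :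
    (∃ v : EuclideanSpace ℝ (Fin n), v ≠ 0 ∧ Matrix.toEuclideanLin A v = lam1 A • v) ∧
      ∀ x : EuclideanSpace ℝ (Fin n), x ≠ 0 → inner ℝ (Matrix.toEuclideanLin A x) x / ‖x‖ ^ 2 ≤ lam1 A := by
  have : Nonempty (Fin n) := ⟨⟨0, hn⟩⟩
  have : Nontrivial (EuclideanSpace ℝ (Fin n)) := inferInstance
  set T := Matrix.toEuclideanLin A with hTdef
  have hT : T.IsSymmetric := toEuc_symm A hA
  set σ : ℝ := ⨆ x : { x : EuclideanSpace ℝ (Fin n) // x ≠ 0 }, inner ℝ (T x) (x : EuclideanSpace ℝ (Fin n)) / ‖(x : EuclideanSpace ℝ (Fin n))‖ ^ 2 with hσ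
  have hev : Module.End.HasEigenvalue T σ := hT.hasEigenvalue_iSup_of_finiteDimensional
  have hbdd : BddAbove (Set.range fun x : { x : EuclideanSpace ℝ (Fin n) // x ≠ 0 } =>
      inner ℝ (T x) (x : EuclideanSpace ℝ (Fin n)) / ‖(x : EuclideanSpace ℝ (Fin n))‖ ^ 2) := by
    refine ⟨‖T.toContinuousLinearMap‖, ?_⟩
    rintro _ ⟨⟨x, hx⟩, rfl⟩
    have hxp : 0 < ‖x‖ := norm_pos_iff.2 hx
    dsimp only
    rw [div_le_iff₀ (by positivity)]
    refine (real_inner_le_norm _ _).trans ?_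
    have := T.toContinuousLinearMap.le_opNorm x
    have := mul_le_mul_of_nonneg_right this hxp.le
    calc ‖T x‖ * ‖x‖ ≤ ‖T.toContinuousLinearMap‖ * ‖x‖ * ‖x‖ := this
      _ = _ := by ring
  have hle : ∀ x : EuclideanSpace ℝ (Fin n), x ≠ 0 → inner ℝ (T x) x / ‖x‖ ^ 2 ≤ σ := fun x hx =>
    le_ciSup hbdd ⟨x, hx⟩
  have hgr : IsGreatest {t : ℝ | ∃ v : Fin n → ℝ, v ≠ 0 ∧ A.mulVec v = t • v} σ := by
    constructor
    · obtain ⟨v, hv⟩ := hev.exists_hasEigenvector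
      refine ⟨v.ofLp, fun h => hv.2 ?_, ?_⟩
      · ext i; simpa using congrFun h i
      · have := hv.apply_eq_smul
        have := congrArg WithLp.ofLp this
        simpa [hTdef] using this
    · rintro t ⟨v, hv, hvt⟩
      have hv' : WithLp.toLp 2 v ≠ 0 := by
        intro h; apply hv
        have := congrArg WithLp.ofLp h
        simpa using this
      have h1 := hle _ hv'
      have h2 : T (WithLp.toLp 2 v) = t • WithLp.toLp 2 v := by
        rw [hTdef, Matrix.toLpLin_toLp]
        rw [Matrix.toLin'_apply, hvt]; rfl
      rw [h2, inner_smul_left, real_inner_self_eq_norm_sq] at h1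
      have h3 : ‖WithLp.toLp 2 v‖ ≠ 0 := norm_ne_zero_iff.2 hv'
      simpa [h3] using h1
  have hlam : lam1 A = σ := hgr.csSup_eq
  rw [hlam]
  obtain ⟨v, hv⟩ := hev.exists_hasEigenvector
  exact ⟨⟨v, hv.2, hv.apply_eq_smul⟩, hle⟩

lemma det_main {n : ℕ} (hn : 1 ≤ n) (X : Matrix (Fin n) (Fin n) ℝ) (hX : X.IsSymm) (l : ℝ) (hl : 0 < l)
    (a U : ℝ) (ha : a = (n : ℝ)⁻¹ * (√(n : ℝ))⁻¹ * ∑ i, ∑ j, X i j)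
    (hU : U = ((n : ℝ) ^ 2)⁻¹ * ∑ i, (∑ j, X i j) ^ 2) :
    |lam1 (((n : ℝ) ^ (-(1 / 2) : ℝ)) • (X + (l / √(n : ℝ)) • onesMat n)) - l - a - (U - a ^ 2) / l| ≤
      36 * ‖(√(n : ℝ))⁻¹ • X‖ ^ 3 / l ^ 2 := by
  have hn0 : (0 : ℝ) < n := by exact_mod_cast hn
  have hsq : √(n : ℝ) * √(n : ℝ) = n := Real.mul_self_sqrt hn0.le
  have hsp : 0 < √(n : ℝ) := by positivity
  have hpow : (n : ℝ) ^ (-(1 / 2) : ℝ) = (√(n : ℝ))⁻¹ := by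
    rw [Real.rpow_neg hn0.le, Real.sqrt_eq_rpow]
  rw [hpow]
  set W := (√(n : ℝ))⁻¹ • X with hW
  set A := (√(n : ℝ))⁻¹ • (X + (l / √(n : ℝ)) • onesMat n) with hA
  have hWs : W.IsSymm := hX.smul _
  have hAs : A.IsSymm := by
    refine Matrix.IsSymm.smul (hX.add (Matrix.IsSymm.smul ?_ _)) _
    ext i j; simp [onesMat]
  obtain ⟨⟨v, hv, hev⟩, hR⟩ := lam1_spec hn A hAs
  set u : EuclideanSpace ℝ (Fin n) := WithLp.toLp 2 (fun _ => (√(n : ℝ))⁻¹) with hu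
  set T := Matrix.toEuclideanLin W with hT
  have huu : ‖u‖ = 1 := by
    have : ‖u‖ ^ 2 = 1 := by
      rw [EuclideanSpace.real_norm_sq_eq]
      simp [hu, hn0.ne']
    exact (pow_eq_one_iff_of_nonneg (norm_nonneg _) two_ne_zero).1 this
  have hinner : ∀ x : EuclideanSpace ℝ (Fin n), inner ℝ u x = (√(n : ℝ))⁻¹ * ∑ i, x i := by
    intro x
    have := toEuc_inner (fun _ : Fin n => (√(n : ℝ))⁻¹) x.ofLp
    rw [Finset.mul_sum]
    exact this
  have hTapp : ∀ (x : EuclideanSpace ℝ (Fin n)) i, T x i = (√(n : ℝ))⁻¹ * ∑ j, X i j * x j := by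
    intro x i
    simp [hT, hW, Matrix.mulVec, dotProduct, Finset.mul_sum, mul_assoc]
  have hAapp : ∀ x : EuclideanSpace ℝ (Fin n),
      Matrix.toEuclideanLin A x = T x + (l * inner ℝ u x) • u := by
    intro x
    ext i
    rw [PiLp.add_apply, hTapp, hinner]
    simp only [hA, onesMat, hu, Matrix.toLpLin_apply, Matrix.mulVec, dotProduct, Matrix.smul_apply, Matrix.add_apply,
      Matrix.of_apply, PiLp.smul_apply, smul_eq_mul, mul_one]
    simp only [mul_assoc, add_mul, mul_add, Finset.sum_add_distrib, ← Finset.mul_sum]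
    field_simp
  have hTw : ∀ x, ‖T x‖ ≤ ‖W‖ * ‖x‖ := fun x => Matrix.l2_opNorm_mulVec W x
  have hu0 : u ≠ 0 := by
    intro h; rw [h, norm_zero] at huu; exact zero_ne_one huu
  have hTu : ∀ i, T u i = (n : ℝ)⁻¹ * ∑ j, X i j := by
    intro i
    rw [hTapp]
    simp only [hu, ← Finset.sum_mul]
    have : (n : ℝ)⁻¹ = (√(n : ℝ))⁻¹ * (√(n : ℝ))⁻¹ := by rw [← mul_inv, hsq]
    rw [this]; ring
  have haa : inner ℝ u (T u) = a := by
    rw [hinner, ha]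
    simp_rw [hTu, ← Finset.mul_sum]
    ring
  have hUU : ‖T u‖ ^ 2 = U := by
    rw [EuclideanSpace.real_norm_sq_eq, hU]
    simp_rw [hTu, mul_pow, ← Finset.mul_sum]
    simp
  have hRu : inner ℝ u (T u) + l ≤ lam1 A := by
    have := hR u hu0
    rw [huu, hAapp, inner_add_left, inner_smul_left, real_inner_self_eq_norm_sq, huu,
      real_inner_comm] at this
    simpa using this
  have key := det_abs T (toEuc_symm W hWs) ‖W‖ (norm_nonneg _) hTw u huu l (lam1 A) hl v hv
    (by rw [← hAapp]; exact hev) hRu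
  rwa [haa, hUU] at key

end det2


/-! ### Second moments of row sums -/

section rows

variable {Ω : Type*} [MeasurableSpace Ω] {μ : Measure Ω} [IsProbabilityMeasure μ]

lemma GV.lin {ι : Type*} [Fintype ι] {Y : ι → Ω → ℝ} (h : GV μ Y) (c : ι → ℝ) (p : ENNReal) (hp : p ≠ ⊤) :
    MemLp (fun ω => ∑ i, c i * Y i ω) p μ := by
  obtain ⟨v, hv⟩ := h.2 c
  have hm : Measurable (fun ω => ∑ i, c i * Y i ω) :=
    Finset.measurable_sum _ fun i _ => (h.1 i).const_mul _
  exact memLp_of_gauss hm.aemeasurable hv p hp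

lemma GV.four {ι : Type*} [Fintype ι] {Y : ι → Ω → ℝ} (h : GV μ Y) (c : ι → ℝ) :
    Integrable (fun ω => (∑ i, c i * Y i ω) ^ 4) μ ∧
    ∫ ω, (∑ i, c i * Y i ω) ^ 4 ∂μ = 3 * (∫ ω, (∑ i, c i * Y i ω) ^ 2 ∂μ) ^ 2 := by
  obtain ⟨v, hv⟩ := h.2 c
  have hm : Measurable (fun ω => ∑ i, c i * Y i ω) :=
    Finset.measurable_sum _ fun i _ => (h.1 i).const_mul _
  have := int_gauss hm.aemeasurable hv 2
  refine ⟨integrable_pow_of_gauss hm.aemeasurable hv 4, ?_⟩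
  norm_num [Nat.doubleFactorial] at this
  rw [this]; ring

lemma GV.quad {ι : Type*} [Fintype ι] {Y : ι → Ω → ℝ} (h : GV μ Y) (c d : ι → ℝ) :
    Integrable (fun ω => (∑ i, c i * Y i ω) ^ 2 * (∑ i, d i * Y i ω) ^ 2) μ ∧
    ∫ ω, (∑ i, c i * Y i ω) ^ 2 * (∑ i, d i * Y i ω) ^ 2 ∂μ =
      (∫ ω, (∑ i, c i * Y i ω) ^ 2 ∂μ) * (∫ ω, (∑ i, d i * Y i ω) ^ 2 ∂μ) +
      2 * (∫ ω, (∑ i, c i * Y i ω) * (∑ i, d i * Y i ω) ∂μ) ^ 2 := by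
  have hA := h.lin c 2 (by simp)
  have hB := h.lin d 2 (by simp)
  have h4A := h.four c
  have h4B := h.four d
  have h4p := h.four (fun i => c i + d i)
  have h4m := h.four (fun i => c i - d i)
  simp only [add_mul, Finset.sum_add_distrib] at h4p
  simp only [sub_mul, Finset.sum_sub_distrib] at h4m
  set A := fun ω => ∑ i, c i * Y i ω with hAd
  set B := fun ω => ∑ i, d i * Y i ω with hBd
  have hA2 : Integrable (fun ω => A ω ^ 2) μ := hA.integrable_sq
  have hB2 : Integrable (fun ω => B ω ^ 2) μ := hB.integrable_sq
  have hAB : Integrable (fun ω => A ω * B ω) μ := hA.integrable_mul hB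
  change (Integrable (fun ω => (A ω + B ω) ^ 4) μ ∧ ∫ ω, (A ω + B ω) ^ 4 ∂μ = 3 * (∫ ω, (A ω + B ω) ^ 2 ∂μ) ^ 2) at h4p
  change (Integrable (fun ω => (A ω - B ω) ^ 4) μ ∧ ∫ ω, (A ω - B ω) ^ 4 ∂μ = 3 * (∫ ω, (A ω - B ω) ^ 2 ∂μ) ^ 2) at h4m
  change (Integrable (fun ω => A ω ^ 4) μ ∧ ∫ ω, A ω ^ 4 ∂μ = 3 * (∫ ω, A ω ^ 2 ∂μ) ^ 2) at h4A
  change (Integrable (fun ω => B ω ^ 4) μ ∧ ∫ ω, B ω ^ 4 ∂μ = 3 * (∫ ω, B ω ^ 2 ∂μ) ^ 2) at h4B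
  change Integrable (fun ω => A ω ^ 2 * B ω ^ 2) μ ∧ ∫ ω, A ω ^ 2 * B ω ^ 2 ∂μ =
    (∫ ω, A ω ^ 2 ∂μ) * (∫ ω, B ω ^ 2 ∂μ) + 2 * (∫ ω, A ω * B ω ∂μ) ^ 2
  have e : ∀ ω, A ω ^ 2 * B ω ^ 2 = (1 / 12) * ((A ω + B ω) ^ 4 + (A ω - B ω) ^ 4 - 2 * A ω ^ 4 - 2 * B ω ^ 4) := by
    intro ω; ring
  have hi := h4p.1
  have hi2 := h4m.1
  have hi3 := h4A.1
  have hi4 := h4B.1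
  have ep : ∫ ω, (A ω + B ω) ^ 2 ∂μ = ∫ ω, A ω ^ 2 ∂μ + 2 * ∫ ω, A ω * B ω ∂μ + ∫ ω, B ω ^ 2 ∂μ := by
    have : ∀ ω, (A ω + B ω) ^ 2 = A ω ^ 2 + 2 * (A ω * B ω) + B ω ^ 2 := fun ω => by ring
    simp_rw [this]
    rw [integral_add (by fun_prop) (by fun_prop), integral_add (by fun_prop) (by fun_prop), integral_const_mul]
  have em : ∫ ω, (A ω - B ω) ^ 2 ∂μ = ∫ ω, A ω ^ 2 ∂μ - 2 * ∫ ω, A ω * B ω ∂μ + ∫ ω, B ω ^ 2 ∂μ := by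
    have : ∀ ω, (A ω - B ω) ^ 2 = A ω ^ 2 - 2 * (A ω * B ω) + B ω ^ 2 := fun ω => by ring
    simp_rw [this]
    rw [integral_add (by fun_prop) (by fun_prop), integral_sub (by fun_prop) (by fun_prop), integral_const_mul]
  simp_rw [e]
  refine ⟨by fun_prop, ?_⟩
  rw [integral_const_mul, integral_sub (by fun_prop) (by fun_prop), integral_sub (by fun_prop) (by fun_prop),
    integral_add (by fun_prop) (by fun_prop), integral_const_mul, integral_const_mul,
    h4p.2, h4m.2, h4A.2, h4B.2, ep, em]
  ring

lemma row_cov_aux (n : ℕ) {X : Ω → Matrix (Fin n) (Fin n) ℝ}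
    (hX : GV μ (fun (p : Fin n × Fin n) ω => X ω p.1 p.2)) (i i' : Fin n) :
    ∫ ω, (∑ j, X ω i j) * (∑ j, X ω i' j) ∂μ = ∑ j, ∑ j', ∫ ω, X ω i j * X ω i' j' ∂μ := by
  classical
  have hm : ∀ i j : Fin n, MemLp (fun ω => X ω i j) 2 μ := by
    intro i j
    have := hX.lin (fun p => if p = (i, j) then 1 else 0) 2 (by simp)
    simpa using this
  have hintg : ∀ i j k l : Fin n, Integrable (fun ω => X ω i j * X ω k l) μ := fun i j k l =>
    (hm i j).integrable_mul (hm k l)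
  simp_rw [Finset.sum_mul_sum]
  rw [integral_finsetSum _ fun j _ => integrable_finsetSum _ fun j' _ => hintg _ _ _ _]
  exact Finset.sum_congr rfl fun j _ => integral_finsetSum _ fun j' _ => hintg _ _ _ _

lemma row_lin (n : ℕ) (X : Matrix (Fin n) (Fin n) ℝ) (i : Fin n) :
    ∑ p : Fin n × Fin n, (if p.1 = i then 1 else 0) * X p.1 p.2 = ∑ j, X i j := by
  rw [Fintype.sum_prod_type]
  simp

lemma row_cov_diag (n : ℕ) {X : Ω → Matrix (Fin n) (Fin n) ℝ}
    (hX : GV μ (fun (p : Fin n × Fin n) ω => X ω p.1 p.2))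
    (hv : ∀ i j, ∫ ω, (X ω i j) ^ 2 ∂μ = 1) (κ : ℝ) (hκ : 0 ≤ κ)
    (hcor : ∀ i j i' j' : Fin n, ¬((i, j) = (i', j') ∨ (i, j) = (j', i')) →
      |∫ ω, X ω i j * X ω i' j' ∂μ| ≤ κ) (i : Fin n) :
    |∫ ω, (∑ j, X ω i j) * (∑ j, X ω i j) ∂μ - n| ≤ n ^ 2 * κ := by
  rw [row_cov_aux n hX]
  have e : ∑ j, ∑ j', ∫ ω, X ω i j * X ω i j' ∂μ - (n : ℝ) =
      ∑ j : Fin n, ∑ j' : Fin n, (∫ ω, X ω i j * X ω i j' ∂μ - if j = j' then 1 else 0) := by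
    simp [Finset.sum_sub_distrib]
  rw [e]
  calc |∑ j : Fin n, ∑ j' : Fin n, (∫ ω, X ω i j * X ω i j' ∂μ - if j = j' then 1 else 0)|
      ≤ ∑ j : Fin n, ∑ j' : Fin n, κ := by
        refine (Finset.abs_sum_le_sum_abs _ _).trans (Finset.sum_le_sum fun j _ => ?_)
        refine (Finset.abs_sum_le_sum_abs _ _).trans (Finset.sum_le_sum fun j' _ => ?_)
        split_ifs with h
        · subst h
          simp_rw [← sq]
          rw [hv]; simpa using hκ
        · rw [sub_zero]
          refine hcor i j i j' ?_
          simp only [Prod.mk.injEq, not_or]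
          refine ⟨fun hh => h hh.2, fun hh => h (hh.2.trans hh.1)⟩
    _ = n ^ 2 * κ := by simp; ring

lemma row_cov_off (n : ℕ) {X : Ω → Matrix (Fin n) (Fin n) ℝ}
    (hX : GV μ (fun (p : Fin n × Fin n) ω => X ω p.1 p.2)) (hs : ∀ ω, (X ω).IsSymm)
    (hv : ∀ i j, ∫ ω, (X ω i j) ^ 2 ∂μ = 1) (κ : ℝ) (hκ : 0 ≤ κ)
    (hcor : ∀ i j i' j' : Fin n, ¬((i, j) = (i', j') ∨ (i, j) = (j', i')) →
      |∫ ω, X ω i j * X ω i' j' ∂μ| ≤ κ) (i i' : Fin n) (hne : i ≠ i') :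
    |∫ ω, (∑ j, X ω i j) * (∑ j, X ω i' j) ∂μ| ≤ 1 + n ^ 2 * κ := by
  rw [row_cov_aux n hX]
  calc |∑ j : Fin n, ∑ j' : Fin n, ∫ ω, X ω i j * X ω i' j' ∂μ|
      ≤ ∑ j : Fin n, ∑ j' : Fin n, ((if i' = j then (if i = j' then 1 else 0) else 0) + κ) := by
        refine (Finset.abs_sum_le_sum_abs _ _).trans (Finset.sum_le_sum fun j _ => ?_)
        refine (Finset.abs_sum_le_sum_abs _ _).trans (Finset.sum_le_sum fun j' _ => ?_)
        by_cases h : (i, j) = (i', j') ∨ (i, j) = (j', i')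
        · simp only [Prod.mk.injEq] at h
          rcases h with h | h
          · exact absurd h.1 hne
          · obtain ⟨h1, h2⟩ := h
            subst h1 h2
            have e : ∫ ω, X ω i j * X ω j i ∂μ = 1 := by
              rw [← hv i j]
              congr 1; ext ω
              rw [(hs ω).apply i j, sq]
            rw [e]; simpa using hκ
        · refine (hcor _ _ _ _ h).trans ?_
          have : (0 : ℝ) ≤ if i' = j then (if i = j' then 1 else 0) else 0 := by
            split_ifs <;> norm_num
          linarith
    _ = 1 + n ^ 2 * κ := by
        simp [Finset.sum_add_distrib]; ring

lemma rows_main (n : ℕ) (hn : 1 ≤ n) {X : Ω → Matrix (Fin n) (Fin n) ℝ}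
    (hX : GV μ (fun (p : Fin n × Fin n) ω => X ω p.1 p.2)) (hs : ∀ ω, (X ω).IsSymm)
    (hv : ∀ i j, ∫ ω, (X ω i j) ^ 2 ∂μ = 1) (κ : ℝ) (hκ : 0 ≤ κ)
    (hcor : ∀ i j i' j' : Fin n, ¬((i, j) = (i', j') ∨ (i, j) = (j', i')) →
      |∫ ω, X ω i j * X ω i' j' ∂μ| ≤ κ) :
    (Integrable (fun ω => (∑ i, (∑ j, X ω i j) ^ 2 - (n : ℝ) ^ 2) ^ 2) μ ∧
      ∫ ω, (∑ i, (∑ j, X ω i j) ^ 2 - (n : ℝ) ^ 2) ^ 2 ∂μ ≤ n ^ 4 * (9 * (n * κ) ^ 2 + 8 / n)) ∧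
    (Integrable (fun ω => (∑ i, ∑ j, X ω i j) ^ 2) μ ∧
      ∫ ω, (∑ i, ∑ j, X ω i j) ^ 2 ∂μ ≤ n ^ 3 * (2 / n + 2 * (n * κ))) := by
  have hn1 : (1 : ℝ) ≤ n := by exact_mod_cast hn
  have hn0 : (0 : ℝ) < n := by linarith
  set S : Fin n → Ω → ℝ := fun i ω => ∑ j, X ω i j with hS
  set c : Fin n → Fin n → ℝ := fun i i' => ∫ ω, S i ω * S i' ω ∂μ with hc
  have hquad : ∀ i i', Integrable (fun ω => S i ω ^ 2 * S i' ω ^ 2) μ ∧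
      ∫ ω, S i ω ^ 2 * S i' ω ^ 2 ∂μ = c i i * c i' i' + 2 * c i i' ^ 2 := by
    intro i i'
    have := hX.quad (fun p => if p.1 = i then 1 else 0) (fun p => if p.1 = i' then 1 else 0)
    simp only [row_lin] at this
    refine ⟨this.1, this.2.trans ?_⟩
    simp only [hc, hS, sq]
  have hm : ∀ i, MemLp (S i) 2 μ := by
    intro i
    have := hX.lin (fun p => if p.1 = i then 1 else 0) 2 (by simp)
    simpa only [row_lin] using this
  have hSS : ∀ i i', Integrable (fun ω => S i ω * S i' ω) μ := fun i i' => (hm i).integrable_mul (hm i')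
  have hS2 : ∀ i, Integrable (fun ω => S i ω ^ 2) μ := fun i => (hm i).integrable_sq
  have hcd : ∀ i, |c i i - n| ≤ n ^ 2 * κ := fun i => row_cov_diag n hX hv κ hκ hcor i
  have hco : ∀ i i', i ≠ i' → |c i i'| ≤ 1 + n ^ 2 * κ := fun i i' h => row_cov_off n hX hs hv κ hκ hcor i i' h
  set t : ℝ := n * κ with ht
  have ht0 : 0 ≤ t := by positivity
  have hcd' : ∀ i, |c i i| ≤ n * (1 + t) := by
    intro i
    have h1 := hcd i
    have h2 := abs_sub_abs_le_abs_sub (c i i) n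
    rw [abs_of_pos hn0] at h2
    have : (n : ℝ) * (1 + t) = n + n ^ 2 * κ := by rw [ht]; ring
    linarith
  have hoff : 1 + (n : ℝ) ^ 2 * κ = 1 + n * t := by rw [ht]; ring
  have hc2 : ∀ i i', c i i' ^ 2 ≤ (if i = i' then (n * (1 + t)) ^ 2 else 0) + (1 + n * t) ^ 2 := by
    intro i i'
    split_ifs with h
    · subst h
      have := pow_le_pow_left₀ (abs_nonneg _) (hcd' i) 2
      rw [sq_abs] at this
      have := sq_nonneg (1 + n * t)
      linarith
    · have := pow_le_pow_left₀ (abs_nonneg _) (hco i i' h) 2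
      rw [sq_abs, hoff] at this
      linarith
  have hc1 : ∀ i i', c i i' ≤ (if i = i' then (n * (1 + t)) else 0) + (1 + n * t) := by
    intro i i'
    split_ifs with h
    · subst h
      have := (le_abs_self _).trans (hcd' i)
      have : 0 ≤ 1 + n * t := by positivity
      linarith
    · have := (le_abs_self _).trans (hco i i' h)
      rw [hoff] at this
      linarith
  refine ⟨?_, ?_⟩
  · have e : ∀ ω, (∑ i, (∑ j, X ω i j) ^ 2 - (n : ℝ) ^ 2) ^ 2 =
        ∑ i, ∑ i', S i ω ^ 2 * S i' ω ^ 2 - 2 * n ^ 2 * ∑ i, S i ω ^ 2 + (n : ℝ) ^ 4 := by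
      intro ω
      rw [← Finset.sum_mul_sum]
      simp only [hS]; ring
    have i1 : Integrable (fun ω => ∑ i, ∑ i', S i ω ^ 2 * S i' ω ^ 2) μ :=
      integrable_finsetSum _ fun i _ => integrable_finsetSum _ fun i' _ => (hquad i i').1
    have i2 : Integrable (fun ω => ∑ i, S i ω ^ 2) μ := integrable_finsetSum _ fun i _ => hS2 i
    simp_rw [e]
    refine ⟨by fun_prop, ?_⟩
    rw [integral_add (by fun_prop) (by fun_prop), integral_sub (by fun_prop) (by fun_prop), integral_const_mul,
      integral_finsetSum _ fun i _ => integrable_finsetSum _ fun i' _ => (hquad i i').1,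
      integral_finsetSum _ fun i _ => hS2 i]
    have e1 : ∀ i, ∫ ω, ∑ i', S i ω ^ 2 * S i' ω ^ 2 ∂μ = ∑ i', (c i i * c i' i' + 2 * c i i' ^ 2) := by
      intro i
      rw [integral_finsetSum _ fun i' _ => (hquad i i').1]
      exact Finset.sum_congr rfl fun i' _ => (hquad i i').2
    have e2 : ∀ i, ∫ ω, S i ω ^ 2 ∂μ = c i i := by intro i; simp only [hc, sq]
    simp_rw [e1, e2, Finset.sum_add_distrib, ← Finset.mul_sum]
    rw [← Finset.sum_mul]
    simp only [integral_const, probReal_univ, smul_eq_mul, one_mul]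
    have b1 : |∑ i, c i i - (n : ℝ) ^ 2| ≤ n ^ 2 * t := by
      have : ∑ i, c i i - (n : ℝ) ^ 2 = ∑ i, (c i i - n) := by
        simp [Finset.sum_sub_distrib, sq]
      rw [this]
      refine (Finset.abs_sum_le_sum_abs _ _).trans ((Finset.sum_le_sum fun i _ => hcd i).trans ?_)
      simp [ht]; exact le_of_eq (by ring)
    have b2 : ∑ i, ∑ i', c i i' ^ 2 ≤ n * (n * (1 + t)) ^ 2 + n ^ 2 * (1 + n * t) ^ 2 := by
      refine (Finset.sum_le_sum fun i _ => Finset.sum_le_sum fun i' _ => hc2 i i').trans (le_of_eq ?_)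
      simp [Finset.sum_add_distrib]; ring
    have b3 : (∑ i, c i i - (n : ℝ) ^ 2) ^ 2 ≤ (n ^ 2 * t) ^ 2 := by
      have := pow_le_pow_left₀ (abs_nonneg _) b1 2
      rwa [sq_abs] at this
    have b4 : (n : ℝ) ^ 4 * (9 * t ^ 2 + 8 / n) = 9 * n ^ 4 * t ^ 2 + 8 * n ^ 3 := by field_simp
    rw [b4]
    have b5 : (1 + t) ^ 2 ≤ 2 + 2 * t ^ 2 := by nlinarith [sq_nonneg (1 - t)]
    have b6 : (1 + n * t) ^ 2 ≤ 2 + 2 * (n * t) ^ 2 := by nlinarith [sq_nonneg (1 - n * t)]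
    have b7 : (n : ℝ) * (n * (1 + t)) ^ 2 + n ^ 2 * (1 + n * t) ^ 2 ≤
        n ^ 3 * (2 + 2 * t ^ 2) + n ^ 2 * (2 + 2 * (n * t) ^ 2) := by
      have : (n : ℝ) * (n * (1 + t)) ^ 2 = n ^ 3 * (1 + t) ^ 2 := by ring
      rw [this]
      gcongr
    have b8 : (n : ℝ) ^ 2 ≤ n ^ 3 := pow_le_pow_right₀ hn1 (by norm_num)
    have b9 : (n : ℝ) ^ 3 * t ^ 2 ≤ n ^ 4 * t ^ 2 := by
      have : (n : ℝ) ^ 3 ≤ n ^ 4 := pow_le_pow_right₀ hn1 (by norm_num)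
      gcongr
    nlinarith
  · have e : ∀ ω, (∑ i, ∑ j, X ω i j) ^ 2 = ∑ i, ∑ i', S i ω * S i' ω := by
      intro ω
      rw [sq, Finset.sum_mul_sum]
    simp_rw [e]
    refine ⟨integrable_finsetSum _ fun i _ => integrable_finsetSum _ fun i' _ => hSS i i', ?_⟩
    rw [integral_finsetSum _ fun i _ => integrable_finsetSum _ fun i' _ => hSS i i']
    have e1 : ∀ i, ∫ ω, ∑ i', S i ω * S i' ω ∂μ = ∑ i', c i i' := fun i =>
      integral_finsetSum _ fun i' _ => hSS i i'
    simp_rw [e1]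
    refine (Finset.sum_le_sum fun i _ => Finset.sum_le_sum fun i' _ => hc1 i i').trans ?_
    simp only [Finset.sum_add_distrib, Finset.sum_ite_eq, Finset.mem_univ, if_true, Finset.sum_const,
      Finset.card_univ, Fintype.card_fin, nsmul_eq_mul]
    have b4 : (n : ℝ) ^ 3 * (2 / n + 2 * t) = 2 * n ^ 2 + 2 * n ^ 3 * t := by field_simp
    rw [b4]
    have b8 : (n : ℝ) ^ 2 * t ≤ n ^ 3 * t := by
      have : (n : ℝ) ^ 2 ≤ n ^ 3 := pow_le_pow_right₀ hn1 (by norm_num)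
      gcongr
    nlinarith

end rows

section final
open scoped Matrix.Norms.L2Operator

lemma log_ev (c e : ℝ) (hc : 0 < c) (he : 0 < e) :
    ∀ᶠ n : ℕ in atTop, Real.log n + 1 ≤ c * (n : ℝ) ^ e := by
  have h1 := (isLittleO_log_rpow_atTop he).def (half_pos hc)
  have h2 : Tendsto (fun x : ℝ => x ^ e) atTop atTop := tendsto_rpow_atTop he
  have h3 := h2.eventually_ge_atTop (2 / c)
  filter_upwards [tendsto_natCast_atTop_atTop.eventually h1,
    tendsto_natCast_atTop_atTop.eventually h3] with n h1 h3
  have hp : (0 : ℝ) ≤ (n : ℝ) ^ e := by positivity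
  rw [Real.norm_eq_abs, Real.norm_eq_abs, abs_of_nonneg hp] at h1
  have := le_abs_self (Real.log n)
  have h4 : 1 ≤ c / 2 * (n : ℝ) ^ e := by
    rw [div_le_iff₀ hc] at h3
    linarith
  linarith

lemma exists_m (C ε : ℝ) (hC : 0 < C) (hε : 0 < ε) :
    ∀ᶠ n : ℕ in atTop, ∃ m : ℕ, 2 ^ m ≤ n ∧ n ≤ 4 ^ (2 ^ m) ∧
      C * (n : ℝ) ^ (-(1 + ε)) * n * (2 * 2 ^ m) ≤ 1 := by
  filter_upwards [log_ev (1 / 2) 1 (by norm_num) one_pos, log_ev (1 / (4 * C)) ε (by positivity) hε,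
    eventually_ge_atTop 3] with n h1 h2 h3
  have hn0 : (0 : ℝ) < n := by exact_mod_cast (show 0 < n by omega)
  have hl : 1 < Real.log n := by
    rw [Real.lt_log_iff_exp_lt hn0]
    have : (3 : ℝ) ≤ n := by exact_mod_cast h3
    have := Real.exp_one_lt_d9
    linarith
  set L := ⌈Real.log n⌉₊ with hL
  have hL1 : Real.log n ≤ L := Nat.le_ceil _
  have hL2 : (L : ℝ) < Real.log n + 1 := Nat.ceil_lt_add_one (by linarith)
  have hL3 : 1 < L := by
    have : (1 : ℝ) < L := by linarith
    exact_mod_cast this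
  set m := Nat.clog 2 L with hm
  have hm1 : L ≤ 2 ^ m := Nat.le_pow_clog (by norm_num) L
  have hm2 : 2 ^ m ≤ 2 * L := by
    have := Nat.pow_pred_clog_lt_self (b := 2) (by norm_num) hL3
    have h0 : 0 < m := Nat.clog_pos (by norm_num) (by omega)
    have h5 : 2 ^ m = 2 * 2 ^ (m - 1) := by
      rw [← pow_succ']; congr 1; omega
    rw [h5]
    have : 2 ^ (m - 1) < L := this
    omega
  have hm2' : (2 : ℝ) ^ m ≤ 2 * L := by exact_mod_cast hm2
  refine ⟨m, ?_, ?_, ?_⟩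
  · rw [Real.rpow_one] at h1
    have : (2 : ℝ) ^ m ≤ n := by linarith
    exact_mod_cast this
  · have : (n : ℝ) ≤ (4 : ℝ) ^ (2 ^ m) := by
      calc (n : ℝ) = Real.exp (Real.log n) := (Real.exp_log hn0).symm
        _ ≤ Real.exp ((2 ^ m : ℕ) : ℝ) := by
            apply Real.exp_le_exp.2
            have : (L : ℝ) ≤ (2 ^ m : ℕ) := by exact_mod_cast hm1
            linarith
        _ = (Real.exp 1) ^ (2 ^ m) := by rw [← Real.exp_nat_mul, mul_one]
        _ ≤ 4 ^ (2 ^ m) := by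
            gcongr
            have := Real.exp_one_lt_d9
            linarith
    exact_mod_cast this
  · have e1 : (n : ℝ) ^ (-(1 + ε)) * n = ((n : ℝ) ^ ε)⁻¹ := by
      rw [← Real.rpow_neg hn0.le, ← Real.rpow_add_one hn0.ne']
      congr 1; ring
    have hp : (0 : ℝ) < (n : ℝ) ^ ε := by positivity
    rw [mul_assoc C, e1]
    have h4 : 2 * (2 : ℝ) ^ m ≤ (n : ℝ) ^ ε / C := by
      have : 1 / (4 * C) * (n : ℝ) ^ ε = (n : ℝ) ^ ε / C / 4 := by field_simp
      rw [this] at h2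
      linarith
    calc C * ((n : ℝ) ^ ε)⁻¹ * (2 * 2 ^ m) ≤ C * ((n : ℝ) ^ ε)⁻¹ * ((n : ℝ) ^ ε / C) := by gcongr
      _ = 1 := by field_simp

lemma tail_R {Ω : Type*} [MeasurableSpace Ω] {μ : Measure Ω} [IsProbabilityMeasure μ]
    (V A : Ω → ℝ) (hV : Integrable (fun ω => V ω ^ 2) μ) (hA : Integrable (fun ω => A ω ^ 2) μ)
    (r c d M : ℝ) (hr : 0 < r) (hr1 : r ≤ 1) (hVi : ∫ ω, V ω ^ 2 ∂μ ≤ c * r ^ 2) (hc : 0 ≤ c) (hd : 0 ≤ d)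
    (hAi : ∫ ω, A ω ^ 2 ∂μ ≤ d * r ^ 2) (hM : 1 ≤ M) :
    (μ {ω | M * r < |V ω - A ω ^ 2|}).toReal ≤ (4 * c + 2 * d) / M := by
  have hM0 : 0 < M := by linarith
  have h1 := mul_meas_ge_le_integral_of_nonneg (μ := μ) (f := fun ω => V ω ^ 2)
    (Eventually.of_forall fun ω => sq_nonneg _) hV ((M * r / 2) ^ 2)
  have h2 := mul_meas_ge_le_integral_of_nonneg (μ := μ) (f := fun ω => A ω ^ 2)
    (Eventually.of_forall fun ω => sq_nonneg _) hA (M * r / 2)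
  have hsub : {ω | M * r < |V ω - A ω ^ 2|} ⊆
      {ω | (M * r / 2) ^ 2 ≤ V ω ^ 2} ∪ {ω | M * r / 2 ≤ A ω ^ 2} := by
    intro ω hω
    by_contra hcon
    simp only [Set.mem_union, Set.mem_ofPred_eq, not_or, not_le] at hcon hω
    have h3 := abs_lt_of_sq_lt_sq hcon.1 (by positivity)
    have h4 := abs_sub (V ω) (A ω ^ 2)
    rw [abs_of_nonneg (sq_nonneg (A ω))] at h4
    linarith [hcon.2]
  have h3 : (μ {ω | M * r < |V ω - A ω ^ 2|}).toReal ≤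
      μ.real {ω | (M * r / 2) ^ 2 ≤ V ω ^ 2} + μ.real {ω | M * r / 2 ≤ A ω ^ 2} :=
    (measureReal_mono hsub).trans (measureReal_union_le _ _)
  have h4 : μ.real {ω | (M * r / 2) ^ 2 ≤ V ω ^ 2} ≤ 4 * c / M := by
    rw [← mul_le_mul_iff_right₀ (show 0 < (M * r / 2) ^ 2 by positivity)]
    refine (h1.trans hVi).trans ?_
    have : (M * r / 2) ^ 2 * (4 * c / M) = M * (c * r ^ 2) := by field_simp; ring
    rw [this]
    exact le_mul_of_one_le_left (by positivity) hM
  have h5 : μ.real {ω | M * r / 2 ≤ A ω ^ 2} ≤ 2 * d / M := by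
    rw [← mul_le_mul_iff_right₀ (show 0 < M * r / 2 by positivity)]
    refine (h2.trans hAi).trans ?_
    have : (M * r / 2) * (2 * d / M) = d * r := by field_simp
    rw [this]
    gcongr
    nlinarith
  rw [add_div]
  linarith

lemma main_R {Ω : Type*} [MeasurableSpace Ω] {μ : Measure Ω} [IsProbabilityMeasure μ]
    (C ε : ℝ) (hC : 0 < C) (hε : 0 < ε) (n : ℕ) (hn : 1 ≤ n) {X : Ω → Matrix (Fin n) (Fin n) ℝ}
    (hX : GV μ (fun (p : Fin n × Fin n) ω => X ω p.1 p.2)) (hs : ∀ ω, (X ω).IsSymm)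
    (hv : ∀ i j, ∫ ω, (X ω i j) ^ 2 ∂μ = 1)
    (hcor : ∀ i j i' j' : Fin n, ¬((i, j) = (i', j') ∨ (i, j) = (j', i')) →
      |∫ ω, X ω i j * X ω i' j' ∂μ| ≤ C * (n : ℝ) ^ (-(1 + ε))) (M : ℝ) (hM : 1 ≤ M) :
    (μ {ω | M * (n : ℝ) ^ (-(min ε 1) / 2) <
      |(((n : ℝ) ^ 2)⁻¹ * ∑ i, (∑ j, X ω i j) ^ 2 -
        ((n : ℝ)⁻¹ * (√(n : ℝ))⁻¹ * ∑ i, ∑ j, X ω i j) ^ 2) - 1|}).toReal ≤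
      (4 * (9 * C ^ 2 + 8) + 2 * (2 + 2 * C)) / M := by
  have hn1 : (1 : ℝ) ≤ n := by exact_mod_cast hn
  have hn0 : (0 : ℝ) < n := by linarith
  obtain ⟨⟨i1, b1⟩, i2, b2⟩ := rows_main n hn hX hs hv (C * (n : ℝ) ^ (-(1 + ε))) (by positivity) hcor
  set r := (n : ℝ) ^ (-(min ε 1) / 2) with hr
  have hr0 : 0 < r := by positivity
  have hmin : 0 < min ε 1 := lt_min hε one_pos
  have hr1 : r ≤ 1 := Real.rpow_le_one_of_one_le_of_nonpos hn1 (by linarith)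
  have hr2 : r ^ 2 = (n : ℝ) ^ (-(min ε 1)) := by
    rw [hr, ← Real.rpow_natCast, ← Real.rpow_mul hn0.le]
    congr 1; push_cast; ring
  have hinv : 1 / (n : ℝ) ≤ r ^ 2 := by
    rw [hr2, one_div, ← Real.rpow_neg_one]
    exact Real.rpow_le_rpow_of_exponent_le hn1 (by linarith [min_le_right ε 1])
  have ht : (n : ℝ) * (C * (n : ℝ) ^ (-(1 + ε))) ≤ C * r ^ 2 := by
    have e1 : (n : ℝ) ^ (-(1 + ε)) * n = (n : ℝ) ^ (-ε) := by
      rw [← Real.rpow_add_one hn0.ne']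
      congr 1; ring
    have : (n : ℝ) * (C * (n : ℝ) ^ (-(1 + ε))) = C * (n : ℝ) ^ (-ε) := by rw [← e1]; ring
    rw [this, hr2]
    gcongr
    exact min_le_left _ _
  have ht0 : 0 ≤ (n : ℝ) * (C * (n : ℝ) ^ (-(1 + ε))) := by positivity
  set t := (n : ℝ) * (C * (n : ℝ) ^ (-(1 + ε))) with htdef
  have hr21 : r ^ 2 ≤ 1 := pow_le_one₀ hr0.le hr1
  have ht2 : t ^ 2 ≤ C ^ 2 * r ^ 2 := by
    calc t ^ 2 ≤ (C * r ^ 2) ^ 2 := by gcongr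
      _ = C ^ 2 * (r ^ 2 * r ^ 2) := by ring
      _ ≤ C ^ 2 * (r ^ 2 * 1) := by gcongr
      _ = _ := by ring
  have hsq : (√(n : ℝ)) ^ 2 = n := Real.sq_sqrt hn0.le
  have eV : (fun ω => (((n : ℝ) ^ 2)⁻¹ * ∑ i, (∑ j, X ω i j) ^ 2 - 1) ^ 2) =
      fun ω => ((n : ℝ) ^ 4)⁻¹ * (∑ i, (∑ j, X ω i j) ^ 2 - (n : ℝ) ^ 2) ^ 2 := by
    funext ω
    field_simp
  have eA : (fun ω => ((n : ℝ)⁻¹ * (√(n : ℝ))⁻¹ * ∑ i, ∑ j, X ω i j) ^ 2) =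
      fun ω => ((n : ℝ) ^ 3)⁻¹ * (∑ i, ∑ j, X ω i j) ^ 2 := by
    funext ω
    rw [mul_pow, mul_pow, inv_pow, inv_pow, hsq]
    congr 1
    field_simp
  have key := tail_R (μ := μ) (fun ω => ((n : ℝ) ^ 2)⁻¹ * ∑ i, (∑ j, X ω i j) ^ 2 - 1)
    (fun ω => (n : ℝ)⁻¹ * (√(n : ℝ))⁻¹ * ∑ i, ∑ j, X ω i j) (by rw [eV]; exact i1.const_mul _)
    (by rw [eA]; exact i2.const_mul _) r (9 * C ^ 2 + 8) (2 + 2 * C) M hr0 hr1 ?_ (by positivity)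
    (by positivity) ?_ hM
  · refine le_trans (le_of_eq ?_) key
    congr 3
    ext ω
    rw [sub_right_comm]
  · rw [eV, integral_const_mul]
    have h8 : 8 / (n : ℝ) = 8 * (1 / n) := by ring
    rw [inv_mul_le_iff₀ (by positivity)]
    refine b1.trans ?_
    gcongr
    rw [h8]
    nlinarith
  · rw [eA, integral_const_mul]
    have h8 : 2 / (n : ℝ) = 2 * (1 / n) := by ring
    rw [inv_mul_le_iff₀ (by positivity)]
    refine b2.trans ?_
    gcongr
    rw [h8]
    nlinarith

lemma l2norm_nn {n : ℕ} (A : Matrix (Fin n) (Fin n) ℝ) : 0 ≤ ‖A‖ := norm_nonneg A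

end final

/-- representation of the largest eigenvalue of the spiked matrix
`Y_n = X_n + (λ_n/√n) 𝟙𝟙ᵀ`:
`√n (λ₁(n^{-1/2} Y_n) - λ_n - 1/λ_n) = (1/n) Σ_{i,j} X_{ij} + (√n/λ_n) O_P(n^{-min{ε,1}/2})
  + O_P(√n/λ_n²)`. -/
theorem largest_eigenvalue_representation
    {Ω : Type*} [MeasureSpace Ω] [IsProbabilityMeasure (volume : Measure Ω)]
    (X : (n : ℕ) → Ω → Matrix (Fin n) (Fin n) ℝ) (C ε : ℝ)
    (hC : 0 < C) (hε : 0 < ε) (hX : CorrGaussian Ω X C ε)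
    (lam : ℕ → ℝ) (D : ℝ) (hD : 0 < D)
    (hlam : ∀ n : ℕ, 1 ≤ n → 4 < lam n ∧ lam n ≤ D * Real.sqrt n) :
    ∃ R R' : ℕ → Ω → ℝ,
      (∀ n : ℕ, 1 ≤ n → ∀ ω,
        Real.sqrt n *
            (lam1 (((n : ℝ) ^ (-(1 / 2) : ℝ)) •
                (X n ω + (lam n / Real.sqrt n) • onesMat n)) - lam n - 1 / lam n) =
          (1 / (n : ℝ)) * (∑ i, ∑ j, X n ω i j) +
            (Real.sqrt n / lam n) * R n ω + R' n ω) ∧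
      IsBigOP R (fun n => (n : ℝ) ^ (-(min ε 1) / 2)) ∧
      IsBigOP R' (fun n => Real.sqrt n / lam n ^ 2) := by
  classical
  refine ⟨fun n ω => (((n : ℝ) ^ 2)⁻¹ * ∑ i, (∑ j, X n ω i j) ^ 2 -
        ((n : ℝ)⁻¹ * (√(n : ℝ))⁻¹ * ∑ i, ∑ j, X n ω i j) ^ 2) - 1,
    fun n ω => √(n : ℝ) * (lam1 (((n : ℝ) ^ (-(1 / 2) : ℝ)) •
                (X n ω + (lam n / Real.sqrt n) • onesMat n)) - lam n -
        ((n : ℝ)⁻¹ * (√(n : ℝ))⁻¹ * ∑ i, ∑ j, X n ω i j) -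
        (((n : ℝ) ^ 2)⁻¹ * ∑ i, (∑ j, X n ω i j) ^ 2 -
        ((n : ℝ)⁻¹ * (√(n : ℝ))⁻¹ * ∑ i, ∑ j, X n ω i j) ^ 2) / lam n), ?_, ?_, ?_⟩
  · intro n hn ω
    have hl := (hlam n hn).1
    have hl0 : lam n ≠ 0 := by linarith
    have hn0 : (0 : ℝ) < n := by exact_mod_cast hn
    have hs : √(n : ℝ) ≠ 0 := by positivity
    beta_reduce
    generalize lam1 _ = L
    generalize (((n : ℝ) ^ 2)⁻¹ * ∑ i, (∑ j, X n ω i j) ^ 2) = U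
    generalize (∑ i, ∑ j, X n ω i j) = S
    have ha : 1 / (n : ℝ) * S = √(n : ℝ) * ((n : ℝ)⁻¹ * (√(n : ℝ))⁻¹ * S) := by
      field_simp
    rw [ha]
    ring
  · intro δ hδ
    refine ⟨max 1 ((4 * (9 * C ^ 2 + 8) + 2 * (2 + 2 * C)) / δ), by positivity, 1, fun n hn => ?_⟩
    refine (main_R C ε hC hε n hn ⟨(hX.gauss n).1, (hX.gauss n).2⟩ (hX.symm n) (hX.var_one n)
      (hX.corr_le n) _ (le_max_left _ _)).trans ?_
    rw [div_le_iff₀ (by positivity), ← div_le_iff₀' hδ]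
    exact le_max_right _ _
  · intro δ hδ
    obtain ⟨n₁, hn₁⟩ := eventually_atTop.1 (exists_m C ε hC hε)
    set M₀ : ℝ := max 64 (192 / δ) with hM₀
    have hM0 : 0 < M₀ := by positivity
    refine ⟨36 * M₀ ^ 3, by positivity, max 1 n₁, fun n hn => ?_⟩
    have hn1 : 1 ≤ n := (le_max_left _ _).trans hn
    have hn0 : (0 : ℝ) < n := by exact_mod_cast hn1
    have hl : 0 < lam n := by linarith [(hlam n hn1).1]
    obtain ⟨m, hm1, hm2, hm3⟩ := hn₁ n ((le_max_right _ _).trans hn)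
    have key := norm_tail (μ := (volume : Measure Ω)) n m hm1 hm2 (X := X n)
      ⟨(hX.gauss n).1, (hX.gauss n).2⟩ (hX.symm n) (hX.var_one n) (C * (n : ℝ) ^ (-(1 + ε)))
      (by positivity) (hX.corr_le n) hm3 M₀ (le_max_left _ _)
    have hfin : 192 / M₀ ≤ δ := by
      rw [div_le_iff₀ hM0, ← div_le_iff₀' hδ]
      exact le_max_right _ _
    refine le_trans (measureReal_mono (μ := (volume : Measure Ω)) ?_) (key.trans hfin)
    intro ω hω
    simp only [Set.mem_ofPred_eq] at hω ⊢
    have hd := det_main hn1 (X n ω) (hX.symm n ω) (lam n) hl _ _ rfl rfl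
    have hsp : 0 < √(n : ℝ) := by positivity
    rw [abs_mul, abs_of_pos hsp] at hω
    have h2 := hω.trans_le (mul_le_mul_of_nonneg_left hd hsp.le)
    by_contra hcon
    rw [not_lt] at hcon
    refine absurd h2 (not_lt.2 ?_)
    have h3 := pow_le_pow_left₀ (l2norm_nn _) hcon 3
    calc _ ≤ √(n : ℝ) * (36 * M₀ ^ 3 / lam n ^ 2) := by gcongr
      _ = _ := by ring
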